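/- (Puder–Parzanchevski) Let r ≥ 1 and w ∈ F_r. Suppose that for every finite group G, the pushforward of the uniform probability measure on G^r under the word map g ↦ w(g) equals the uniform probability measure on G. Then w is primitive: there exists an automorphism α of F_r with α(x_1) = w. -/

import Mathlib

open MeasureTheory

namespace FreeGroup

/-- The prefixes of the word `L` at which the free derivative of `L` with respect to the
generator `i` is supported. -/
def foxTerms {α : Type*} [DecidableEq α] (i : α) : List (α × Bool) → List (FreeGroup α)
  | [] => []
  | s :: L => (if s.1 = i then [if s.2 then 1 else mk [s]] else []) ++
      (foxTerms i L).map (mk [s] * ·)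

section Affine

variable {W : Type*} [AddCommGroup W] [Module (ZMod 2) W]

/-- The contragredient action of the general linear group on the dual space. -/
noncomputable def dualAction :
    (W ≃ₗ[ZMod 2] W) →* MulAut (Multiplicative (Module.Dual (ZMod 2) W)) where
  toFun g := AddEquiv.toMultiplicative (g⁻¹).dualMap.toAddEquiv
  map_one' := rfl
  map_mul' g h := by
    ext x
    rfl

theorem toAdd_dualAction_apply (g : W ≃ₗ[ZMod 2] W)
    (x : Multiplicative (Module.Dual (ZMod 2) W)) (v : W) :
    (dualAction g x).toAdd v = x.toAdd (g⁻¹ v) := rfl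

theorem mk_cons_eq {α : Type*} (s : α × Bool) (L : List (α × Bool)) :
    (mk (s :: L) : FreeGroup α) = mk [s] * mk L := by
  simp [mul_mk]

theorem lift_mk_singleton {α G : Type*} [Group G] (f : α → G) (s : α × Bool) :
    lift f (mk [s]) = cond s.2 (f s.1) (f s.1)⁻¹ := by
  simp [lift_mk]

variable {r : ℕ}

theorem lift_affine_right (g : Fin r → Multiplicative (Module.Dual (ZMod 2) W) ⋊[dualAction]
    (W ≃ₗ[ZMod 2] W)) (x : FreeGroup (Fin r)) :
    (lift g x).right = lift (fun i => (g i).right) x := by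
  have : (SemidirectProduct.rightHom.comp (lift g)) = lift (fun i => (g i).right) := by
    ext i
    simp
  exact DFunLike.congr_fun this x

theorem lift_affine_left (g : Fin r → Multiplicative (Module.Dual (ZMod 2) W) ⋊[dualAction]
    (W ≃ₗ[ZMod 2] W)) (L : List (Fin r × Bool)) (v : W) :
    (lift g (mk L)).left.toAdd v = ∑ i, ((foxTerms i L).map
      fun q => (g i).left.toAdd ((lift (fun i => (g i).right) q)⁻¹ v)).sum := by
  induction L generalizing v with
  | nil =>
    have : (mk [] : FreeGroup (Fin r)) = 1 := rfl
    simp [foxTerms, this]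
  | cons s L ih =>
    rw [mk_cons_eq, _root_.map_mul, SemidirectProduct.mul_left, toAdd_mul, LinearMap.add_apply,
      toAdd_dualAction_apply, ih, lift_affine_right]
    simp only [foxTerms, List.map_append, List.sum_append, Finset.sum_add_distrib, List.map_map]
    congr 1
    · rw [Finset.sum_eq_single s.1]
      · rcases s with ⟨j, _ | _⟩
        · rw [lift_mk_singleton]
          simp only [cond_false, SemidirectProduct.inv_left, toAdd_dualAction_apply, if_true,
            Bool.false_eq_true, if_false, List.map_cons, List.map_nil, List.sum_singleton,
            lift_mk_singleton, inv_inv, toAdd_inv]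
          exact ZMod.neg_eq_self_mod_two _
        · rw [lift_mk_singleton]
          simp only [cond_true, if_true, List.map_cons, List.map_nil, List.sum_singleton,
            _root_.map_one, inv_one]
          rfl
      · intro b _ hb
        simp [hb.symm]
      · simp
    · refine Finset.sum_congr rfl fun i _ => ?_
      congr 1
      refine List.map_congr_left fun q _ => ?_
      simp only [Function.comp_apply, _root_.map_mul, mul_inv_rev, LinearEquiv.mul_apply]

theorem exists_foxTerms_sum_ne_zero {W : Type} [AddCommGroup W] [Module (ZMod 2) W] [Finite W]
    (L : List (Fin r × Bool))
    (h : ∀ (G : Type) [Group G] [Finite G] (a b : G),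
      Nat.card {g : Fin r → G // lift g (mk L) = a} =
        Nat.card {g : Fin r → G // lift g (mk L) = b})
    (ρ : Fin r → W ≃ₗ[ZMod 2] W) {v : W} (hv : v ≠ 0) :
    ∃ i, ((foxTerms i L).map fun q => (lift ρ q)⁻¹ v).sum ≠ 0 := by
  classical
  by_contra! hall
  let D := Module.Dual (ZMod 2) W
  let G := Multiplicative D ⋊[dualAction] (W ≃ₗ[ZMod 2] W)
  obtain ⟨μ, hμ⟩ : ∃ μ : D, μ v ≠ 0 := by
    by_contra! hc
    exact hv ((Module.forall_dual_apply_eq_zero_iff (ZMod 2) v).1 hc)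
  have : Finite (W ≃ₗ[ZMod 2] W) :=
    Finite.of_injective (fun e => (e : W → W)) DFunLike.coe_injective
  have : Finite D := Finite.of_injective (fun e => (e : W → ZMod 2)) DFunLike.coe_injective
  have : Finite (Multiplicative D) := this
  have : Finite G := Finite.of_equiv _ SemidirectProduct.equivProd.symm
  let S (m : D) := {g : Fin r → G // lift g (mk L) =
    (⟨Multiplicative.ofAdd m, lift ρ (mk L)⟩ : G)}
  have key (m : D) (g : Fin r → G) : lift g (mk L) =
      (⟨Multiplicative.ofAdd m, lift ρ (mk L)⟩ : G) ↔
      lift (fun i => (g i).right) (mk L) = lift ρ (mk L) ∧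
      ∀ x, ∑ i, ((foxTerms i L).map
      fun q => (g i).left.toAdd ((lift (fun i => (g i).right) q)⁻¹ x)).sum = m x := by
    rw [SemidirectProduct.ext_iff, ← lift_affine_right, and_comm]
    refine and_congr_right fun _ => ?_
    simp_rw [← lift_affine_left]
    rw [← Multiplicative.toAdd.injective.eq_iff, LinearMap.ext_iff]
    rfl
  let base (σ : Fin r → W ≃ₗ[ZMod 2] W) : Fin r → D :=
    if hc : ∃ l : Fin r → D, ∀ x, ∑ i, ((foxTerms i L).map
      fun q => l i ((lift σ q)⁻¹ x)).sum = μ x then hc.choose else 0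
  have hbase (g : Fin r → G) (hg : lift g (mk L) =
      (⟨Multiplicative.ofAdd μ, lift ρ (mk L)⟩ : G)) (x : W) :
      ∑ i, ((foxTerms i L).map
      fun q => base (fun i => (g i).right) i ((lift (fun i => (g i).right) q)⁻¹ x)).sum = μ x := by
    have hc : ∃ l : Fin r → D, ∀ x, ∑ i, ((foxTerms i L).map
      fun q => l i ((lift (fun i => (g i).right) q)⁻¹ x)).sum = μ x :=
      ⟨fun i => (g i).left.toAdd, ((key _ _).1 hg).2⟩
    simp only [base, dif_pos hc]
    exact hc.choose_spec x
  have sub_sum (l l' : Module.Dual (ZMod 2) W) (M : List (FreeGroup (Fin r)))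
      (f : FreeGroup (Fin r) → W) :
      (M.map fun q => (l - l') (f q)).sum =
        (M.map fun q => l (f q)).sum - (M.map fun q => l' (f q)).sum := by
    induction M with
    | nil => simp
    | cons a M ih => 
      simp only [List.map_cons, List.sum_cons]
      rw [ih, LinearMap.sub_apply]
      ring
  let shift (g : S μ) : S 0 := ⟨fun i => ⟨Multiplicative.ofAdd
    ((g.1 i).left.toAdd - base (fun i => (g.1 i).right) i), (g.1 i).right⟩, by
      rw [key]
      refine ⟨((key _ _).1 g.2).1, fun x => ?_⟩
      simp only [toAdd_ofAdd, sub_sum, Finset.sum_sub_distrib, hbase g.1 g.2,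
        ((key _ _).1 g.2).2, sub_self]
      rfl⟩
  have shift_inj : Function.Injective shift := by
    intro g g' hgg
    have h1 (i) : (shift g).1 i = (shift g').1 i := congrFun (congrArg Subtype.val hgg) i
    have hr : (fun i => (g.1 i).right) = (fun i => (g'.1 i).right) := by
      funext i
      have := congrArg SemidirectProduct.right (h1 i)
      exact this
    ext i : 2
    refine SemidirectProduct.ext ?_ (congrFun hr i)
    have h2 : (g.1 i).left.toAdd - base (fun i => (g.1 i).right) i =
      (g'.1 i).left.toAdd - base (fun i => (g'.1 i).right) i :=
      congrArg (fun x => (SemidirectProduct.left x).toAdd) (h1 i)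
    rw [hr, sub_left_inj] at h2
    exact Multiplicative.toAdd.injective h2
  have hzero : lift (fun i => (⟨1, ρ i⟩ : G)) (mk L) =
      (⟨Multiplicative.ofAdd 0, lift ρ (mk L)⟩ : G) := by
    rw [key]
    refine ⟨rfl, fun x => ?_⟩
    have h0 (M : List (FreeGroup (Fin r))) : (M.map fun _ => (0 : ZMod 2)).sum = 0 := by simp
    exact Finset.sum_eq_zero fun i _ => h0 _
  have hbij : Function.Bijective shift :=
    shift_inj.bijective_of_nat_card_le (h G _ _).ge
  obtain ⟨g, hg⟩ := hbij.2 ⟨_, hzero⟩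
  have hr : (fun i => (g.1 i).right) = ρ := by
    funext i
    exact congrArg SemidirectProduct.right (congrFun (congrArg Subtype.val hg) i)
  have h3 := ((key _ _).1 g.2).2 v
  rw [hr] at h3
  apply hμ
  rw [← h3]
  refine Finset.sum_eq_zero fun i _ => ?_
  have := congrArg (g.1 i).left.toAdd (hall i)
  rwa [map_list_sum, List.map_map, map_zero] at this

end Affine

theorem card_fiber_eq_of_uniform {r : ℕ} {w : FreeGroup (Fin r)}
    (h : ∀ (G : Type) [Group G] [Fintype G] [MeasurableSpace G]
        [MeasurableSingletonClass G],
        Measure.map (fun g : Fin r → G => FreeGroup.lift g w)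
            ((Fintype.card (Fin r → G) : ENNReal)⁻¹ • Measure.count)
          = (Fintype.card G : ENNReal)⁻¹ • Measure.count)
    (G : Type) [Group G] [Finite G] (a b : G) :
    Nat.card {g : Fin r → G // lift g w = a} = Nat.card {g : Fin r → G // lift g w = b} := by
  have := Fintype.ofFinite G
  let _ : MeasurableSpace G := ⊤
  have hG := h G
  have hm : Measurable (fun g : Fin r → G => FreeGroup.lift g w) := measurable_of_finite _
  have key (c : G) : (Fintype.card (Fin r → G) : ENNReal)⁻¹ *
      (Nat.card {g : Fin r → G // lift g w = c} : ENNReal) = (Fintype.card G : ENNReal)⁻¹ := by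
    have := congrArg (fun μ => μ {c}) hG
    simp only [Measure.smul_apply, smul_eq_mul] at this
    rw [Measure.map_apply hm (measurableSet_singleton c), Measure.count_singleton, mul_one] at this
    rw [← this, Measure.smul_apply, smul_eq_mul,
      Measure.count_apply (Set.toFinite _).measurableSet]
    congr 1
    rw [← Set.Finite.cast_ncard_eq (Set.toFinite _)]
    rfl
  have := (key a).trans (key b).symm
  rw [ENNReal.mul_right_inj (by simp) (by simp)] at this
  exact_mod_cast this

section Extension

variable {r : ℕ}

/-- The right regular action on functions, restricted to a finite-dimensional subspace wherever
it preserves it, extends to an automorphism of that subspace. -/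
theorem exists_linearEquiv_extending {V : Type*} [AddCommGroup V] [Module (ZMod 2) V]
    (W : Submodule (ZMod 2) V) [FiniteDimensional (ZMod 2) W] (X : V ≃ₗ[ZMod 2] V) :
    ∃ e : W ≃ₗ[ZMod 2] W, ∀ f : W, X f ∈ W → (e f : V) = X f := by
  let S : Submodule (ZMod 2) W := (W.comap X.toLinearMap).comap W.subtype
  let f : S →ₗ[ZMod 2] W := LinearMap.codRestrict W (X.toLinearMap ∘ₗ W.subtype ∘ₗ S.subtype)
    fun x => x.2
  have hf : Function.Injective f := by
    intro x y hxy
    have := congrArg Subtype.val hxy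
    exact Subtype.ext (Subtype.ext (X.injective this))
  obtain ⟨g, hg⟩ := Submodule.exists_linearEquiv_restrict_eq (LinearEquiv.ofInjective f hf)
  refine ⟨g, fun w hw => ?_⟩
  have := hg ⟨w, hw⟩
  have h2 := congrArg Subtype.val this
  exact h2.symm

/-- If the action of the letters on `W` agrees with `X` whenever possible, then the actions agree
along the inverses of the prefixes of `L`, as long as the path stays in `W`. -/
theorem foxTerms_sum_agree {V : Type*} [AddCommGroup V] [Module (ZMod 2) V]
    (W : Submodule (ZMod 2) V) (X : Fin r → V ≃ₗ[ZMod 2] V) (ρ : Fin r → W ≃ₗ[ZMod 2] W)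
    (hρ : ∀ i (f : W), X i f ∈ W → (ρ i f : V) = X i f) (i : Fin r) (L : List (Fin r × Bool))
    (x : W) (hx : ∀ P, P <+: L → (lift X (mk P))⁻¹ (x : V) ∈ W) :
    ((((foxTerms i L).map fun q => (lift ρ q)⁻¹ x).sum : W) : V) =
      ((foxTerms i L).map fun q => (lift X q)⁻¹ (x : V)).sum := by
  induction L generalizing x with
  | nil => simp [foxTerms]
  | cons s L ih =>
    have hs : (((lift ρ (mk [s]))⁻¹ x : W) : V) = (lift X (mk [s]))⁻¹ (x : V) := by
      have hmem := hx [s] (by simp)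
      rw [lift_mk_singleton] at hmem
      rw [lift_mk_singleton, lift_mk_singleton]
      rcases s with ⟨j, _ | _⟩
      · simp only [cond_false, inv_inv] at hmem ⊢
        exact hρ j x hmem
      · simp only [cond_true] at hmem ⊢
        have h1 := hρ j ⟨_, hmem⟩ (by
          change X j ((X j).symm x) ∈ W
          simp)
        have h2 : ρ j ⟨_, hmem⟩ = x := by
          apply Subtype.ext
          rw [h1]
          exact (X j).apply_symm_apply x
        have h3 : (ρ j)⁻¹ x = ⟨_, hmem⟩ := by
          conv_lhs => rw [← h2]
          exact (ρ j).symm_apply_apply _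
        rw [h3]
    have ih' := ih ((lift ρ (mk [s]))⁻¹ x) (fun P hP => by
      have := hx (s :: P) (by simpa using hP)
      rwa [mk_cons_eq, _root_.map_mul, mul_inv_rev, LinearEquiv.mul_apply, ← hs] at this)
    rw [hs] at ih'
    simp only [foxTerms, List.map_append, List.sum_append, List.map_map, Submodule.coe_add]
    congr 1
    · by_cases hi : s.1 = i
      · rcases s with ⟨j, _ | _⟩
        · obtain rfl : j = i := hi
          simp
          exact hs
        · obtain rfl : j = i := hi
          simp
          rfl
      · simp [hi]
    · convert ih' using 3
      · congr 1
        funext q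
        simp only [Function.comp_apply, _root_.map_mul, mul_inv_rev, LinearEquiv.mul_apply]
      · funext q
        simp only [Function.comp_apply, _root_.map_mul, mul_inv_rev, LinearEquiv.mul_apply]

/-- Right translation on functions on the free group. -/
def rightTranslation (g : FreeGroup (Fin r)) :
    (FreeGroup (Fin r) → ZMod 2) ≃ₗ[ZMod 2] (FreeGroup (Fin r) → ZMod 2) :=
  LinearEquiv.funCongrLeft (ZMod 2) (ZMod 2) (Equiv.mulRight g)

theorem lift_rightTranslation_apply (g h : FreeGroup (Fin r)) (f : FreeGroup (Fin r) → ZMod 2) :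
    lift (fun i => rightTranslation (of i)) g f h = f (h * g) := by
  induction g using FreeGroup.induction_on generalizing h f with
  | C1 => simp
  | of i => simp [rightTranslation]
  | inv_of i _ =>
    simp only [_root_.map_inv, lift_apply_of]
    have : f = rightTranslation (of i) (fun x => f (x * (of i)⁻¹)) := by
      funext x
      simp [rightTranslation]
    conv_lhs => rw [this]
    change (rightTranslation (of i)).symm (rightTranslation (of i) _) h = _
    rw [LinearEquiv.symm_apply_apply]
  | mul x y hx hy =>
    rw [_root_.map_mul, LinearEquiv.mul_apply, hx, hy, mul_assoc]

theorem single_one_mem_span (L : List (Fin r × Bool))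
    (h : ∀ (W : Type) [AddCommGroup W] [Module (ZMod 2) W] [Finite W]
      (ρ : Fin r → W ≃ₗ[ZMod 2] W) {v : W} (_ : v ≠ 0),
      ∃ i, ((foxTerms i L).map fun q => (lift ρ q)⁻¹ v).sum ≠ 0) :
    Finsupp.single (1 : FreeGroup (Fin r)) (1 : ZMod 2) ∈ Submodule.span (ZMod 2)
      (Set.range fun p : Fin r × FreeGroup (Fin r) =>
        ((foxTerms p.1 L).map fun q => Finsupp.single (p.2 * q⁻¹) (1 : ZMod 2)).sum) := by
  by_contra hmem
  obtain ⟨f, hf1, hf⟩ := Submodule.exists_le_ker_of_notMem hmem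
  let κ : FreeGroup (Fin r) → ZMod 2 := fun g => f (Finsupp.single g 1)
  have hκ (i) (g) : ((foxTerms i L).map fun q => κ (g * q⁻¹)).sum = 0 := by
    have := hf (Submodule.subset_span ⟨(i, g), rfl⟩)
    rw [LinearMap.mem_ker, map_list_sum, List.map_map] at this
    exact this
  let X : Fin r → _ := fun i => rightTranslation (r := r) (of i)
  let W : Submodule (ZMod 2) (FreeGroup (Fin r) → ZMod 2) := Submodule.span (ZMod 2)
    ((fun P => (lift X (mk P))⁻¹ κ) '' {P | P <+: L})
  have hfin : {P | P <+: L}.Finite := by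
    refine (List.finite_toSet L.inits).subset fun P hP => ?_
    simpa using hP
  have : FiniteDimensional (ZMod 2) W := FiniteDimensional.span_of_finite _ (hfin.image _)
  have : Finite W := Module.finite_of_finite (ZMod 2)
  choose ρ hρ using fun i => exists_linearEquiv_extending W (X i)
  have hP (P) (hP : P <+: L) : (lift X (mk P))⁻¹ κ ∈ W := Submodule.subset_span ⟨P, hP, rfl⟩
  have hκW : κ ∈ W := by
    have := hP [] (by simp)
    have h1 : (mk [] : FreeGroup (Fin r)) = 1 := rfl
    rw [h1] at this
    simpa using this
  obtain ⟨i, hi⟩ := h W ρ (v := ⟨κ, hκW⟩) (by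
    intro h0
    have := congrFun (congrArg Subtype.val h0) 1
    exact hf1 this)
  apply hi
  apply Subtype.ext
  rw [foxTerms_sum_agree W X ρ hρ i L ⟨κ, hκW⟩ hP]
  funext g
  simp only [← _root_.map_inv]
  have hsum (M : List (FreeGroup (Fin r))) :
      (M.map fun q => lift X q⁻¹ κ).sum g = (M.map fun q => κ (g * q⁻¹)).sum := by
    induction M with
    | nil => rfl
    | cons a M ih =>
      simp only [List.map_cons, List.sum_cons, Pi.add_apply]
      rw [ih, lift_rightTranslation_apply]
  rw [hsum]
  exact hκ i g

theorem exists_potential (b : Fin r → FreeGroup (Fin r) → ZMod 2) :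
    ∃ φ : FreeGroup (Fin r) → ZMod 2, ∀ h i, φ (h * of i) = φ h + b i h := by
  let σ (i : Fin r) : Equiv.Perm (FreeGroup (Fin r) × ZMod 2) :=
    { toFun := fun p => (p.1 * of i, p.2 + b i p.1)
      invFun := fun p => (p.1 * (of i)⁻¹, p.2 - b i (p.1 * (of i)⁻¹))
      left_inv := fun p => by simp
      right_inv := fun p => by simp }
  let H := lift fun i => (σ i)⁻¹
  have h1 (g : FreeGroup (Fin r)) : ∀ p, ((H g)⁻¹ p).1 = p.1 * g := by
    induction g using FreeGroup.induction_on with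
    | C1 => simp
    | of i => intro p; simp [H, σ]
    | inv_of i _ =>
      intro p
      simp only [H, _root_.map_inv, lift_apply_of, inv_inv]
      rfl
    | mul x y hx hy =>
      intro p
      rw [_root_.map_mul, mul_inv_rev, Equiv.Perm.mul_apply, hy, hx, mul_assoc]
  refine ⟨fun g => ((H g)⁻¹ (1, 0)).2, fun h i => ?_⟩
  have : (H (h * of i))⁻¹ = σ i * (H h)⁻¹ := by simp [H]
  beta_reduce
  rw [this, Equiv.Perm.mul_apply]
  change _ + b i ((H h)⁻¹ (1, 0)).1 = _
  rw [h1, one_mul]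

theorem potential_mul_mk {φ : FreeGroup (Fin r) → ZMod 2}
    {b : Fin r → FreeGroup (Fin r) → ZMod 2} (hφ : ∀ h i, φ (h * of i) = φ h + b i h)
    (L : List (Fin r × Bool)) (h : FreeGroup (Fin r)) :
    φ (h * mk L) = φ h + ∑ i, ((foxTerms i L).map fun q => b i (h * q)).sum := by
  induction L generalizing h with
  | nil =>
    have : (mk [] : FreeGroup (Fin r)) = 1 := rfl
    simp [foxTerms, this]
  | cons s L ih =>
    rw [mk_cons_eq, ← mul_assoc, ih]
    simp only [foxTerms, List.map_append, List.sum_append, Finset.sum_add_distrib, List.map_map]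
    rw [← add_assoc]
    congr 1
    · rw [Finset.sum_eq_single s.1]
      · rcases s with ⟨j, _ | _⟩
        · have h2 := hφ (h * mk [(j, false)]) j
          have h3 : (mk [(j, false)] : FreeGroup (Fin r)) = (of j)⁻¹ := rfl
          rw [h3, inv_mul_cancel_right] at h2
          rw [h2, h3]
          simp [add_assoc, CharTwo.add_self_eq_zero]
        · have h3 : (mk [(j, true)] : FreeGroup (Fin r)) = of j := rfl
          rw [h3, hφ]
          simp
      · intro b _ hb
        simp [hb.symm]
      · simp
    · refine Finset.sum_congr rfl fun i _ => ?_
      congr 1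
      refine List.map_congr_left fun q _ => ?_
      simp [mul_assoc]

theorem sum_smul_single_translate {G : Type*} [Group G] (c : G → ZMod 2) (g : G) (T : Finset G)
    (M : List G) (hM : ∀ q ∈ M, g * q ∈ T) :
    ∑ y ∈ T, (c y • (M.map fun q => Finsupp.single (y * q⁻¹) (1 : ZMod 2)).sum) g =
      (M.map fun q => c (g * q)).sum := by
  classical
  induction M with
  | nil => simp
  | cons a M ih =>
    simp only [List.map_cons, List.sum_cons, Finsupp.smul_apply, Finsupp.add_apply,
      smul_add, Finset.sum_add_distrib] at ih ⊢
    rw [ih fun q hq => hM q (List.mem_cons_of_mem _ hq)]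
    congr 1
    rw [Finset.sum_eq_single (g * a)]
    · simp
    · intro y _ hy
      rw [Finsupp.single_apply, if_neg, smul_zero]
      rintro rfl
      simp at hy
    · intro hn
      exact absurd (hM a (by simp)) hn

theorem exists_almost_invariant (L : List (Fin r × Bool))
    (h : Finsupp.single (1 : FreeGroup (Fin r)) (1 : ZMod 2) ∈ Submodule.span (ZMod 2)
      (Set.range fun p : Fin r × FreeGroup (Fin r) =>
        ((foxTerms p.1 L).map fun q => Finsupp.single (p.2 * q⁻¹) (1 : ZMod 2)).sum)) :
    ∃ φ : FreeGroup (Fin r) → ZMod 2,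
      (∀ i, {h | φ (h * of i) ≠ φ h}.Finite) ∧
      ∀ h, φ (h * mk L) = φ h + if h = 1 then 1 else 0 := by
  classical
  obtain ⟨c, hc⟩ := (Finsupp.mem_span_range_iff_exists_finsupp).1 h
  obtain ⟨φ, hφ⟩ := exists_potential (r := r) fun i g => c (i, g)
  refine ⟨φ, fun i => ?_, fun g => ?_⟩
  · refine (c.support.finite_toSet.preimage (f := fun g => (i, g)) ?_).subset fun g hg => ?_
    · intro a _ b _ hab
      exact (Prod.ext_iff.1 hab).2
    · simp only [Set.mem_ofPred_eq, hφ, ne_eq, add_eq_left] at hg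
      simpa using hg
  · rw [potential_mul_mk hφ]
    congr 1
    have h1 := DFunLike.congr_fun hc g
    rw [Finsupp.single_apply] at h1
    simp only [eq_comm (a := g)]
    rw [← h1, Finsupp.sum_apply, Finsupp.sum_of_support_subset c (s := Finset.univ ×ˢ
      (c.support.image Prod.snd ∪ Finset.univ.biUnion fun i =>
        ((foxTerms i L).map fun q => g * q).toFinset)), Finset.sum_product]
    · refine Finset.sum_congr rfl fun i _ => ?_
      refine (sum_smul_single_translate (fun g => c (i, g)) g _ _ fun q hq => ?_).symm
      refine Finset.mem_union_right _ (Finset.mem_biUnion.2 ⟨i, Finset.mem_univ i, ?_⟩)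
      exact List.mem_toFinset.2 (List.mem_map_of_mem hq)
    · intro p hp
      simp only [Finset.mem_product, Finset.mem_univ, true_and, Finset.mem_union]
      left
      exact Finset.mem_image_of_mem _ hp
    · simp

end Extension

section Words

variable {α : Type*}

/-- The inverse of a letter. -/
def invLetter (s : α × Bool) : α × Bool := (s.1, !s.2)

@[simp]
theorem invLetter_invLetter (s : α × Bool) : invLetter (invLetter s) = s := by
  simp [invLetter]

theorem invLetter_ne (s : α × Bool) : invLetter s ≠ s := by
  intro h
  simpa [invLetter] using congrArg Prod.snd h

theorem invLetter_eq_comm {s t : α × Bool} : invLetter s = t ↔ s = invLetter t :=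
  ⟨fun h => by rw [← h, invLetter_invLetter], fun h => by rw [h, invLetter_invLetter]⟩

theorem mk_invLetter (s : α × Bool) : mk [invLetter s] = (mk [s])⁻¹ := by
  simp [invLetter, inv_mk, invRev]

theorem reduced_pair_iff {s t : α × Bool} : (s.1 = t.1 → s.2 = t.2) ↔ t ≠ invLetter s := by
  obtain ⟨a, b⟩ := s
  obtain ⟨c, d⟩ := t
  simp only [invLetter, ne_eq, Prod.mk.injEq, not_and]
  constructor
  · rintro h rfl; have := h rfl; cases b <;> cases d <;> simp_all
  · rintro h rfl; have := h rfl; cases b <;> cases d <;> simp_all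

variable [DecidableEq α]

theorem toWord_letter_mul {z : α × Bool} {g : FreeGroup α}
    (h : g.toWord.head? ≠ some (invLetter z)) : (mk [z] * g).toWord = z :: g.toWord := by
  have hr : IsReduced (z :: g.toWord) := by
    have hg : IsReduced g.toWord := isReduced_toWord
    cases hL : g.toWord with
    | nil => simp
    | cons t L =>
      rw [hL] at hg h
      rw [isReduced_cons_cons, reduced_pair_iff]
      exact ⟨by simpa using h, hg⟩
  have : mk [z] * g = mk (z :: g.toWord) := by
    conv_lhs => rw [← mk_toWord (x := g), mul_mk]
    rfl
  rw [this, toWord_mk, hr.reduce_eq]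

theorem head_letter_mul_iff {z : α × Bool} {g : FreeGroup α} :
    (mk [z] * g).toWord.head? = some z ↔ g.toWord.head? ≠ some (invLetter z) := by
  constructor
  · intro h h'
    have h1 : (mk [z] * g).toWord.head? ≠ some (invLetter (invLetter z)) →
        (mk [invLetter z] * (mk [z] * g)).toWord = invLetter z :: (mk [z] * g).toWord :=
      toWord_letter_mul
    obtain ⟨L, hL⟩ : ∃ L, g.toWord = invLetter z :: L := by
      cases hg : g.toWord with
      | nil => simp [hg] at h'
      | cons t L => rw [hg] at h'; simp at h'; exact ⟨L, by rw [h']⟩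
    have hg : IsReduced g.toWord := isReduced_toWord
    have hg' : g = mk [invLetter z] * mk L := by
      rw [mul_mk, ← mk_toWord (x := g), hL]; rfl
    have hLr : IsReduced L := by rw [hL] at hg; exact hg.infix ⟨[invLetter z], [], by simp⟩
    have : mk [z] * g = mk L := by
      rw [hg', mk_invLetter, mul_inv_cancel_left]
    rw [this, toWord_mk, hLr.reduce_eq] at h
    cases L with
    | nil => simp at h
    | cons t L =>
      rw [hL, isReduced_cons_cons, reduced_pair_iff] at hg
      simp at h
      exact hg.1 (by rw [invLetter_invLetter, h])
  · intro h
    rw [toWord_letter_mul h]; rfl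

theorem toWord_mul_letter (u : FreeGroup α) (y : α × Bool) :
    (u * mk [y]).toWord = u.toWord ++ [y] ∨
      u.toWord = (u * mk [y]).toWord ++ [invLetter y] := by
  have hu : IsReduced u.toWord := isReduced_toWord
  rcases List.eq_nil_or_concat u.toWord with hn | ⟨M, x, hM⟩
  · left
    have : u = 1 := toWord_eq_nil_iff.1 hn
    subst this
    simp [toWord_mk]
  · rw [List.concat_eq_append] at hM
    by_cases hxy : x = invLetter y
    · right
      rw [hM] at hu
      have hMr : IsReduced M := hu.infix ⟨[], [x], by simp⟩
      have : u * mk [y] = mk M := by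
        rw [← mk_toWord (x := u), hM, ← mul_mk, hxy, mk_invLetter, inv_mul_cancel_right]
      rw [this, toWord_mk, hMr.reduce_eq, hM, hxy]
    · left
      have hr : IsReduced (u.toWord ++ [y]) := by
        rw [hM] at hu ⊢
        unfold IsReduced at hu ⊢
        rw [List.isChain_append]
        refine ⟨hu, by simp, ?_⟩
        intro p hp q hq
        simp at hp hq
        subst hp hq
        rw [reduced_pair_iff]
        intro h
        exact hxy (by rw [h, invLetter_invLetter])
      have : u * mk [y] = mk (u.toWord ++ [y]) := by
        rw [← mul_mk, mk_toWord]
      rw [this, toWord_mk, hr.reduce_eq]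

theorem head_mul_letter {g : FreeGroup α} {y : α × Bool} (hg : g ≠ 1) (hgy : g * mk [y] ≠ 1) :
    (g * mk [y]).toWord.head? = g.toWord.head? := by
  have hg : g.toWord ≠ [] := fun h => hg (toWord_eq_nil_iff.1 h)
  have hgy : (g * mk [y]).toWord ≠ [] := fun h => hgy (toWord_eq_nil_iff.1 h)
  rcases toWord_mul_letter g y with h | h
  · rw [h, List.head?_append_of_ne_nil _ hg]
  · rw [h, List.head?_append_of_ne_nil _ hgy]

/-- The first letter of the reduced word leading from `v` to `u`. -/
def dir (v u : FreeGroup α) : Option (α × Bool) := (v⁻¹ * u).toWord.head?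

theorem dir_eq_none_iff {v u : FreeGroup α} : dir v u = none ↔ u = v := by
  unfold dir
  rw [List.head?_eq_none_iff, toWord_eq_nil_iff, inv_mul_eq_one, eq_comm]

@[simp]
theorem dir_mul_left (h v u : FreeGroup α) : dir (h * v) (h * u) = dir v u := by
  simp [dir, mul_assoc]

theorem dir_mul_letter {v u : FreeGroup α} {y : α × Bool} (hu : u ≠ v) (huy : u * mk [y] ≠ v) :
    dir v (u * mk [y]) = dir v u := by
  unfold dir
  rw [← mul_assoc]
  apply head_mul_letter
  · rwa [ne_eq, inv_mul_eq_one, eq_comm]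
  · rwa [mul_assoc, ne_eq, inv_mul_eq_one, eq_comm]

theorem dir_self_mul_letter (v : FreeGroup α) (y : α × Bool) : dir v (v * mk [y]) = some y := by
  simp [dir, toWord_mk]

/-- A reduced path `X` with letters `t`, as long as it is not trivial, leaves its starting point
through the letter `t 0`. -/
theorem dir_path {t : ℕ → α × Bool} {X : ℕ → FreeGroup α}
    (hX : ∀ k, X (k + 1) = X k * mk [t k]) (ht : ∀ k, t (k + 1) ≠ invLetter (t k)) (k : ℕ) :
    dir (X 0) (X (k + 1)) = some (t 0) := by
  induction k generalizing t X with
  | zero => rw [hX, dir_self_mul_letter]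
  | succ k ih =>
    have h1 := ih (t := fun k => t (k + 1)) (X := fun k => X (k + 1))
      (fun k => hX _) (fun k => ht _)
    simp only [zero_add] at h1
    have h2 : (X 0)⁻¹ * X (k + 1 + 1) = mk [t 0] * ((X 1)⁻¹ * X (k + 1 + 1)) := by
      rw [hX 0]; group
    unfold dir at h1 ⊢
    rw [h2, head_letter_mul_iff, h1]
    simpa using ht 0

/-- The elements whose reduced word starts with the reduced word of `v`. -/
def cone (v : FreeGroup α) : Set (FreeGroup α) := {u | v.toWord <+: u.toWord}

theorem mem_cone_self (v : FreeGroup α) : v ∈ cone v := List.prefix_rfl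

theorem eq_of_mul_letter_mem_cone {v u : FreeGroup α} {y : α × Bool} (hu : u ∉ cone v)
    (huy : u * mk [y] ∈ cone v) : u * mk [y] = v := by
  unfold cone at hu huy
  simp only [Set.mem_ofPred_eq] at hu huy
  rcases toWord_mul_letter u y with h | h
  · rw [h] at huy
    rcases List.prefix_concat_iff.1 huy with h' | h'
    · exact toWord_injective (by rw [h, h'])
    · exact absurd h' hu
  · exact absurd (huy.trans ⟨_, h.symm⟩) hu

theorem toWord_mul_of_head_ne {v g : FreeGroup α} {L : List (α × Bool)} {b : α × Bool}
    (hv : v.toWord = L ++ [b]) (hg : g.toWord.head? ≠ some (invLetter b)) :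
    (v * g).toWord = v.toWord ++ g.toWord := by
  have hr : IsReduced (v.toWord ++ g.toWord) := by
    have h1 : IsReduced v.toWord := isReduced_toWord
    have h2 : IsReduced g.toWord := isReduced_toWord
    unfold IsReduced at *
    rw [List.isChain_append]
    refine ⟨h1, h2, ?_⟩
    intro p hp q hq
    rw [hv] at hp
    simp only [List.getLast?_append, List.getLast?_singleton, Option.some_or, Option.mem_def,
      Option.some.injEq] at hp hq
    subst hp
    rw [reduced_pair_iff]
    rintro rfl
    exact hg hq
  have : v * g = mk (v.toWord ++ g.toWord) := by
    rw [← mul_mk, mk_toWord, mk_toWord]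
  rw [this, toWord_mk, hr.reduce_eq]

theorem mem_cone_iff {v : FreeGroup α} {L : List (α × Bool)} {b : α × Bool}
    (hv : v.toWord = L ++ [b]) (u : FreeGroup α) :
    u ∈ cone v ↔ dir v u ≠ some (invLetter b) := by
  constructor
  · rintro ⟨N, hN⟩ h
    have hu : IsReduced u.toWord := isReduced_toWord
    rw [← hN] at hu
    have hNr : IsReduced N := hu.infix ⟨v.toWord, [], by simp⟩
    have : v⁻¹ * u = mk N := by
      rw [inv_mul_eq_iff_eq_mul, ← mk_toWord (x := u), ← hN, ← mul_mk, mk_toWord]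
    rw [dir, this, toWord_mk, hNr.reduce_eq] at h
    unfold IsReduced at hu
    rw [List.isChain_append] at hu
    have := hu.2.2 b (by simp [hv]) _ h
    rw [reduced_pair_iff] at this
    exact this rfl
  · intro h
    have := toWord_mul_of_head_ne hv h
    rw [mul_inv_cancel_left] at this
    exact ⟨_, this.symm⟩

theorem toWord_mul_letter_of_ne {v : FreeGroup α} {L : List (α × Bool)} {b y : α × Bool}
    (hv : v.toWord = L ++ [b]) (hy : y ≠ invLetter b) : (v * mk [y]).toWord = v.toWord ++ [y] := by
  rcases toWord_mul_letter v y with h | h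
  · exact h
  · rw [hv] at h
    have := List.append_inj_right' h rfl
    simp at this
    exact absurd (by rw [this, invLetter_invLetter]) hy

theorem mem_cone_mul_letter {v u : FreeGroup α} {L : List (α × Bool)} {b y : α × Bool}
    (hv : v.toWord = L ++ [b]) (hy : y ≠ invLetter b) (hu : dir v u = some y) :
    u ∈ cone (v * mk [y]) := by
  have h := toWord_mul_of_head_ne hv (g := v⁻¹ * u) (by
    unfold dir at hu
    rw [hu]
    simpa using hy)
  rw [mul_inv_cancel_left] at h
  cases hL : (v⁻¹ * u).toWord with
  | nil => simp [dir, hL] at hu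
  | cons t M =>
    have ht : t = y := by simpa [dir, hL] using hu
    refine ⟨M, ?_⟩
    rw [h, hL, toWord_mul_letter_of_ne hv hy, ht]
    simp

end Words

section AxisDef

variable {α : Type*}

/-- The bi-infinite reduced path `X` with letters `s` on which a cyclically reduced word `w` of
length `n` acts as a translation by `n`. -/
structure Axis (w : FreeGroup α) (n : ℕ) where
  s : ℤ → α × Bool
  X : ℤ → FreeGroup α
  pos : 0 < n
  s_add : ∀ m, s (m + n) = s m
  s_ne : ∀ m, s (m + 1) ≠ invLetter (s m)
  X_zero : X 0 = 1
  X_succ : ∀ m, X (m + 1) = X m * mk [s m]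
  X_add : ∀ m, X (m + n) = w * X m

theorem Axis.X_add_mul {w : FreeGroup α} {n : ℕ} (A : Axis w n) (m k : ℤ) :
    A.X (m + k * n) = w ^ k * A.X m := by
  induction k using Int.induction_on with
  | zero => simp
  | succ k ih => rw [add_mul, one_mul, ← add_assoc, A.X_add, ih, ← mul_assoc, ← zpow_one_add,
      add_comm]
  | pred k ih =>
    have := A.X_add (m + (-k - 1) * n)
    rw [show m + (-k - 1) * n + n = m + -(k : ℤ) * n by ring, ih] at this
    rw [show (-k - 1 : ℤ) = -1 + -k by ring, zpow_add, mul_assoc, this, zpow_neg_one,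
      inv_mul_cancel_left]
    congr 1; ring

variable [DecidableEq α]

theorem exists_axis {w : FreeGroup α} (hw : w ≠ 1) (hc : IsCyclicallyReduced w.toWord) :
    Nonempty (Axis w w.norm) := by
  obtain ⟨L, hL⟩ : ∃ L, w.toWord = L := ⟨_, rfl⟩
  have hn : w.norm = L.length := by rw [norm, hL]
  have hpos : 0 < L.length := by
    rw [List.length_pos_iff, ← hL]; exact fun h => hw (toWord_eq_nil_iff.1 h)
  have hwL : w = mk L := by rw [← hL, mk_toWord]
  have hposZ : (0 : ℤ) < L.length := by exact_mod_cast hpos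
  rw [hL] at hc
  rw [hn]
  have hlt (m : ℤ) : (m % L.length).toNat < L.length := by
    have h1 := Int.emod_nonneg m hposZ.ne'
    have h2 := Int.emod_lt_of_pos m hposZ
    omega
  have hcase (m : ℤ) :
      ((m % L.length).toNat + 1 < L.length ∧ (m + 1) / L.length = m / L.length ∧
        ((m + 1) % L.length).toNat = (m % L.length).toNat + 1) ∨
      ((m % L.length).toNat + 1 = L.length ∧ (m + 1) / L.length = m / L.length + 1 ∧
        ((m + 1) % L.length).toNat = 0) := by
    have h1 := Int.emod_nonneg m hposZ.ne'
    have h2 := Int.emod_lt_of_pos m hposZ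
    have h3 := Int.emod_add_mul_ediv m L.length
    by_cases h : m % L.length + 1 < L.length
    · left
      have h4 := (Int.ediv_emod_unique (a := m + 1) (r := m % L.length + 1) (q := m / L.length)
        hposZ).2 ⟨by linarith, by omega, h⟩
      refine ⟨by omega, h4.1, ?_⟩
      rw [h4.2]; omega
    · right
      have h4 := (Int.ediv_emod_unique (a := m + 1) (r := 0) (q := m / L.length + 1)
        hposZ).2 ⟨by linarith, le_rfl, hposZ⟩
      refine ⟨by omega, h4.1, ?_⟩
      rw [h4.2]; rfl
  exact ⟨{
    s := fun m => L[(m % L.length).toNat]'(hlt m)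
    X := fun m => w ^ (m / L.length) * mk (L.take (m % L.length).toNat)
    pos := hpos
    s_add := fun m => by simp
    s_ne := fun m => by
      rw [ne_eq, ← ne_eq, ← reduced_pair_iff]
      rcases hcase m with ⟨h1, -, h3⟩ | ⟨h1, -, h3⟩
      · have := List.isChain_iff_getElem.1 hc.isReduced (m % L.length).toNat h1
        simpa only [h3] using this
      · have := hc.2 (L[(m % L.length).toNat]'(hlt m)) (by
          rw [Option.mem_def, List.getLast?_eq_getElem?, List.getElem?_eq_some_iff]
          exact ⟨by omega, by congr 1; omega⟩) (L[0]) (by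
          rw [List.head?_eq_getElem?]; simp)
        simpa only [h3] using this
    X_zero := by simp [← one_eq_mk]
    X_succ := fun m => by
      rcases hcase m with ⟨h1, h2, h3⟩ | ⟨h1, h2, h3⟩
      · rw [h2, h3, List.take_succ_eq_append_getElem (hlt m), ← mul_mk, mul_assoc]
      · rw [h2, h3, zpow_add_one, mul_assoc, mul_assoc, List.take_zero, mul_mk,
          ← List.take_succ_eq_append_getElem (hlt m), h1, List.take_length, ← hwL, ← one_eq_mk,
          mul_one]
    X_add := fun m => by
      rw [Int.add_emod_right, Int.add_ediv_of_dvd_right dvd_rfl, Int.ediv_self hposZ.ne', add_comm,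
        zpow_one_add, mul_assoc]
     }⟩

namespace Axis

variable {w : FreeGroup α} {n : ℕ} (A : Axis w n)

theorem s_add_mul (m k : ℤ) : A.s (m + k * n) = A.s m := by
  have := A.X_succ (m + k * n)
  rw [show m + k * n + 1 = (m + 1) + k * n by ring, X_add_mul, X_add_mul, mul_assoc,
    mul_right_inj, A.X_succ, mul_right_inj] at this
  have := congrArg toWord this
  simpa [toWord_mk] using this.symm

theorem dir_fwd {m m' : ℤ} (h : m < m') : dir (A.X m) (A.X m') = some (A.s m) := by
  obtain ⟨k, rfl⟩ : ∃ k : ℕ, m' = m + (k + 1 : ℕ) := ⟨(m' - m - 1).toNat, by omega⟩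
  have := dir_path (t := fun k : ℕ => A.s (m + k)) (X := fun k : ℕ => A.X (m + k))
    (fun k => by
      have := A.X_succ (m + k)
      simpa [add_assoc] using this)
    (fun k => by
      have := A.s_ne (m + k)
      simpa [add_assoc] using this) k
  simpa using this

theorem dir_bwd {m m' : ℤ} (h : m' < m) :
    dir (A.X m) (A.X m') = some (invLetter (A.s (m - 1))) := by
  obtain ⟨k, rfl⟩ : ∃ k : ℕ, m' = m - (k + 1 : ℕ) := ⟨(m - m' - 1).toNat, by omega⟩
  have := dir_path (t := fun k : ℕ => invLetter (A.s (m - 1 - k))) (X := fun k : ℕ => A.X (m - k))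
    (fun k => by
      have := A.X_succ (m - (k + 1 : ℕ))
      rw [mk_invLetter, eq_mul_inv_iff_mul_eq]
      rw [show m - ((k + 1 : ℕ) : ℤ) + 1 = m - k by push_cast; ring] at this
      rw [this, show m - ((k + 1 : ℕ) : ℤ) = m - 1 - k by push_cast; ring])
    (fun k => by
      have := A.s_ne (m - 1 - (k + 1 : ℕ))
      rw [show m - 1 - ((k + 1 : ℕ) : ℤ) + 1 = m - 1 - k by push_cast; ring] at this
      rw [invLetter_invLetter]
      exact fun h => this h.symm) k
  simpa using this

theorem X_injective : Function.Injective A.X := by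
  intro m m' h
  by_contra hne
  rcases lt_or_gt_of_ne hne with h' | h'
  · have := A.dir_fwd h'
    rw [dir_eq_none_iff.2 h.symm] at this
    simp at this
  · have := A.dir_bwd h'
    rw [dir_eq_none_iff.2 h.symm] at this
    simp at this

end Axis

end AxisDef

section PeriodCount

open Classical in
/-- The number of `0 ≤ m < n` satisfying `p`. -/
noncomputable def periodCount (n : ℕ) (p : ℤ → Prop) : ℕ :=
  ∑ m ∈ Finset.range n, if p m then 1 else 0

theorem periodCount_add_one {n : ℕ} {p : ℤ → Prop} (hp : ∀ m, p (m + n) ↔ p m) :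
    periodCount n (fun m => p (m + 1)) = periodCount n p := by
  classical
  have h1 := Finset.sum_range_succ' (fun m : ℕ => if p (m : ℤ) then 1 else 0) n
  have h2 := Finset.sum_range_succ (fun m : ℕ => if p (m : ℤ) then 1 else 0) n
  have h3 := hp 0
  rw [zero_add] at h3
  rw [h2] at h1
  simp only [h3, Nat.cast_add, Nat.cast_one, Nat.cast_zero] at h1
  unfold periodCount
  convert (Nat.add_right_cancel h1).symm

theorem periodCount_mono {n : ℕ} {p q : ℤ → Prop} (h : ∀ m, p m → q m) :
    periodCount n p ≤ periodCount n q := by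
  classical
  unfold periodCount
  refine Finset.sum_le_sum fun m _ => ?_
  have := h m
  split_ifs <;> simp_all

theorem periodCount_or_le {n : ℕ} (p q : ℤ → Prop) :
    periodCount n (fun m => p m ∨ q m) ≤ periodCount n p + periodCount n q := by
  classical
  unfold periodCount
  rw [← Finset.sum_add_distrib]
  refine Finset.sum_le_sum fun m _ => ?_
  split_ifs <;> simp_all

theorem periodCount_add_le {n : ℕ} {p q t : ℤ → Prop} (hd : ∀ m, p m → ¬ q m)
    (hp : ∀ m, p m → t m) (hq : ∀ m, q m → t m) :
    periodCount n p + periodCount n q ≤ periodCount n t := by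
  classical
  unfold periodCount
  rw [← Finset.sum_add_distrib]
  refine Finset.sum_le_sum fun m _ => ?_
  have := hd m
  have := hp m
  have := hq m
  split_ifs <;> simp_all

theorem periodic_emod {n : ℕ} {p : ℤ → Prop} (hp : ∀ m, p (m + n) ↔ p m) (m : ℤ) :
    p (m % n) ↔ p m := by
  have h : ∀ (k : ℕ) m, p (m + k * n) ↔ p m := by
    intro k
    induction k with
    | zero => simp
    | succ k ih => intro m; rw [← ih m, ← hp (m + k * n)]; push_cast; ring_nf
  have h3 := Int.emod_add_mul_ediv m n
  rcases Int.eq_nat_or_neg (m / n) with ⟨k, hk | hk⟩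
  · rw [hk, mul_comm] at h3
    rw [← h k, h3]
  · rw [hk] at h3
    rw [← h k m]
    conv_rhs => rw [← h3]
    ring_nf

theorem periodCount_eq_zero_iff {n : ℕ} {p : ℤ → Prop} (hn : 0 < n) (hp : ∀ m, p (m + n) ↔ p m) :
    periodCount n p = 0 ↔ ∀ m, ¬ p m := by
  classical
  constructor
  · intro h m hm
    unfold periodCount at h
    have h1 := Int.emod_nonneg m (b := n) (by omega)
    have h2 := Int.emod_lt_of_pos m (b := n) (by omega)
    have := (Finset.sum_eq_zero_iff.1 h) (m % n).toNat (Finset.mem_range.2 (by omega))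
    rw [Int.toNat_of_nonneg h1, if_pos ((periodic_emod hp m).2 hm)] at this
    simp at this
  · intro h
    simp [periodCount, h]

theorem dvd_sub_of_periodCount_le_one {n : ℕ} {p : ℤ → Prop} (hn : 0 < n)
    (hp : ∀ m, p (m + n) ↔ p m) (hc : periodCount n p ≤ 1) {m m' : ℤ} (hm : p m) (hm' : p m') :
    (n : ℤ) ∣ m - m' := by
  classical
  have h1 (m : ℤ) := Int.emod_nonneg m (b := n) (by omega)
  have h2 (m : ℤ) := Int.emod_lt_of_pos m (b := n) (by omega)
  unfold periodCount at hc
  rw [Finset.sum_boole, Nat.cast_id, Finset.card_le_one] at hc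
  have h3 (m : ℤ) (hm : p m) :
      (m % n).toNat ∈ (Finset.range n).filter (fun m : ℕ => p m) := by
    rw [Finset.mem_filter, Finset.mem_range, Int.toNat_of_nonneg (h1 m)]
    have := h1 m
    have := h2 m
    exact ⟨by omega, (periodic_emod hp m).2 hm⟩
  have := hc _ (h3 m hm) _ (h3 m' hm')
  have h4 := h1 m
  have h5 := h1 m'
  exact Int.ModEq.dvd (show m' % n = m % n by omega)

theorem periodCount_le_one_of_dvd {n : ℕ} {p : ℤ → Prop}
    (h : ∀ m m', p m → p m' → (n : ℤ) ∣ m - m') : periodCount n p ≤ 1 := by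
  classical
  unfold periodCount
  rw [Finset.sum_boole, Nat.cast_id, Finset.card_le_one]
  intro a ha b hb
  rw [Finset.mem_filter, Finset.mem_range] at ha hb
  have := Int.eq_zero_of_abs_lt_dvd (h _ _ ha.2 hb.2) (by rw [abs_lt]; omega)
  omega

end PeriodCount

section Whitehead

variable {α : Type*}

open Classical in
/-- The endomorphism multiplying the letters in `P` by `u` on the left. -/
noncomputable def whiteheadHom (P : Set (α × Bool)) (u : FreeGroup α) :
    FreeGroup α →* FreeGroup α :=
  lift fun i => (if (i, true) ∈ P then u else 1) * of i * (if (i, false) ∈ P then u else 1)⁻¹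

open Classical in
theorem whiteheadHom_mk (P : Set (α × Bool)) (u : FreeGroup α) (y : α × Bool) :
    whiteheadHom P u (mk [y]) =
      (if y ∈ P then u else 1) * mk [y] * (if invLetter y ∈ P then u else 1)⁻¹ := by
  obtain ⟨i, b⟩ := y
  cases b
  · have : (mk [(i, false)] : FreeGroup α) = (of i)⁻¹ := rfl
    rw [this, _root_.map_inv, whiteheadHom, lift_apply_of]
    simp only [invLetter, Bool.not_false, mul_inv_rev, inv_inv, mul_assoc]
  · have : (mk [(i, true)] : FreeGroup α) = of i := rfl
    rw [this, whiteheadHom, lift_apply_of]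
    simp [invLetter]

theorem whiteheadHom_mk_self {P : Set (α × Bool)} {a : α × Bool} (u : FreeGroup α) (ha : a ∉ P)
    (ha' : invLetter a ∉ P) : whiteheadHom P u (mk [a]) = mk [a] := by
  rw [whiteheadHom_mk, if_neg ha, if_neg ha']
  simp

theorem whiteheadHom_comp {P : Set (α × Bool)} {u v : FreeGroup α} (huv : u * v = 1)
    (hv : whiteheadHom P u v = v) (x : FreeGroup α) :
    whiteheadHom P u (whiteheadHom P v x) = x := by
  classical
  suffices (whiteheadHom P u).comp (whiteheadHom P v) = MonoidHom.id _ from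
    DFunLike.congr_fun this x
  ext i
  have hvu : u = v⁻¹ := eq_inv_of_mul_eq_one_left huv
  rw [MonoidHom.comp_apply, MonoidHom.id_apply]
  conv_lhs => enter [2]; rw [whiteheadHom, lift_apply_of]
  have h1 : whiteheadHom P u (of i) = _ := whiteheadHom_mk P u (i, true)
  have h2 (q : Prop) [Decidable q] :
      whiteheadHom P u (if q then v else 1) = if q then v else 1 := by
    split_ifs <;> simp [hv]
  rw [_root_.map_mul, _root_.map_mul, _root_.map_inv, h1, h2, h2, hvu]
  change _ * (_ * of i * _) * _ = _
  simp only [invLetter, Bool.not_true]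
  split_ifs <;> simp [mul_assoc]

/-- The Whitehead automorphism multiplying the letters in `P` by `a` on the left. -/
noncomputable def whiteheadEquiv (P : Set (α × Bool)) (a : α × Bool) (ha : a ∉ P)
    (ha' : invLetter a ∉ P) : FreeGroup α ≃* FreeGroup α where
  toFun := whiteheadHom P (mk [a])
  invFun := whiteheadHom P (mk [a])⁻¹
  left_inv := whiteheadHom_comp (inv_mul_cancel _) (whiteheadHom_mk_self _ ha ha')
  right_inv := whiteheadHom_comp (mul_inv_cancel _) (by
    rw [_root_.map_inv, whiteheadHom_mk_self _ ha ha'])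
  map_mul' := _root_.map_mul _

variable [DecidableEq α]

theorem norm_letter_le (y : α × Bool) : norm (mk [y]) ≤ 1 := norm_mk_le

/-- A pair of letters, different from `a`, which is separated by `P`. -/
def Cut (P : Set (α × Bool)) (a x y : α × Bool) : Prop :=
  x ≠ a ∧ y ≠ a ∧ Xor (x ∈ P) (y ∈ P)

/-- A pair of letters, one of which is `a` and the other one is in `P`. -/
def Meet (P : Set (α × Bool)) (a x y : α × Bool) : Prop :=
  (x = a ∧ y ∈ P) ∨ (y = a ∧ x ∈ P)

open Classical in
/-- The part of the Whitehead image of the letter `y` ending with `y`. -/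
noncomputable def whiteheadLeft (P : Set (α × Bool)) (a y : α × Bool) : FreeGroup α :=
  if y = invLetter a then 1 else (if y ∈ P then mk [a] else 1) * mk [y]

open Classical in
/-- The part of the Whitehead image of the letter `y` following `y`. -/
noncomputable def whiteheadRight (P : Set (α × Bool)) (a y : α × Bool) : FreeGroup α :=
  if y = invLetter a then mk [invLetter a] else (if invLetter y ∈ P then mk [a] else 1)⁻¹

theorem whiteheadLeft_mul_right {P : Set (α × Bool)} {a : α × Bool} (ha : a ∉ P)
    (ha' : invLetter a ∉ P) (y : α × Bool) :
    whiteheadLeft P a y * whiteheadRight P a y = whiteheadHom P (mk [a]) (mk [y]) := by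
  rw [whiteheadHom_mk, whiteheadLeft, whiteheadRight]
  by_cases hy : y = invLetter a
  · subst hy
    simp [ha, ha']
  · simp [hy]

open Classical in
theorem norm_whitehead_pair {P : Set (α × Bool)} {a : α × Bool} (ha : a ∉ P)
    (ha' : invLetter a ∉ P) {y z : α × Bool} (hz : z ≠ invLetter y) :
    norm (whiteheadRight P a y * whiteheadLeft P a z) +
        (if Meet P a (invLetter y) z then 1 else 0) ≤
      (if y = invLetter a then 1 else 0) + (if z ≠ invLetter a then 1 else 0) +
        (if Cut P a (invLetter y) z then 1 else 0) := by
  have h1 (y : α × Bool) := norm_letter_le y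
  have h2 (y : α × Bool) : norm ((mk [y])⁻¹) ≤ 1 := norm_inv_eq.trans_le (h1 y)
  have h3 (y z : α × Bool) : norm ((mk [y])⁻¹ * mk [z]) ≤ 2 :=
    (norm_mul_le _ _).trans (add_le_add (h2 y) (h1 z))
  have h4 (y z : α × Bool) : norm (mk [y] * mk [z]) ≤ 2 :=
    (norm_mul_le _ _).trans (add_le_add (h1 y) (h1 z))
  unfold whiteheadLeft whiteheadRight Meet Cut
  have hia := invLetter_ne a
  by_cases hy : y = invLetter a
  · subst hy
    rw [invLetter_invLetter] at *
    by_cases hz' : z = invLetter a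
    · subst hz'
      simp [-mul_mk, -inv_mk, ha', hia, h1]
    · by_cases hzP : z ∈ P
      · simp [-mul_mk, -inv_mk, hz', hzP, ha, mk_invLetter, h1, hz]
      · simp [-mul_mk, -inv_mk, hz', hzP, ha, mk_invLetter, hz]
        exact h3 a z
  · have hx : invLetter y ≠ a := fun h => hy (invLetter_eq_comm.1 h)
    by_cases hz' : z = invLetter a
    · subst hz'
      by_cases hxP : invLetter y ∈ P
      · simp [-mul_mk, -inv_mk, hy, hx, hxP, ha', hia, h1]
      · simp [-mul_mk, -inv_mk, hy, hx, hxP, ha', hia, Xor]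
    · by_cases hza : z = a
      · subst hza
        by_cases hxP : invLetter y ∈ P
        · simp [-mul_mk, -inv_mk, hy, hx, hxP, ha, hz']
        · simp [-mul_mk, -inv_mk, hy, hx, hxP, ha, hz', h1]
      · by_cases hxP : invLetter y ∈ P <;> by_cases hzP : z ∈ P
        · simp [-mul_mk, -inv_mk, hy, hx, hxP, hzP, hza, hz', h1, Xor]
        · simp [-mul_mk, -inv_mk, hy, hx, hxP, hzP, hza, hz', h3, Xor]
        · simp [-mul_mk, -inv_mk, hy, hx, hxP, hzP, hza, hz', h4, Xor]
        · simp [-mul_mk, -inv_mk, hy, hx, hxP, hzP, hza, hz', h1, Xor]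

theorem Axis.periodCount_meet_le {w : FreeGroup α} {n : ℕ} (A : Axis w n)
    (hmin : ∀ β : FreeGroup α ≃* FreeGroup α, n ≤ norm (β w)) {P : Set (α × Bool)} {a : α × Bool}
    (ha : a ∉ P) (ha' : invLetter a ∉ P) :
    periodCount n (fun m => Meet P a (invLetter (A.s m)) (A.s (m + 1))) ≤
      periodCount n (fun m => Cut P a (invLetter (A.s m)) (A.s (m + 1))) := by
  classical
  let τ := whiteheadEquiv P a ha ha'
  let l := whiteheadLeft P a
  let R := whiteheadRight P a
  have hτ (y : α × Bool) : τ (FreeGroup.mk [y]) = l y * R y :=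
    (whiteheadLeft_mul_right ha ha' y).symm
  have key (k : ℕ) : norm ((l (A.s 0))⁻¹ * τ (A.X k) * l (A.s k)) ≤
      ∑ m ∈ Finset.range k, norm (R (A.s m) * l (A.s (m + 1))) := by
    induction k with
    | zero => simp [A.X_zero]
    | succ k ih =>
      rw [Finset.sum_range_succ]
      refine le_trans (le_of_eq ?_) ((norm_mul_le _ _).trans (Nat.add_le_add_right ih _))
      congr 1
      push_cast
      rw [A.X_succ, _root_.map_mul, hτ]
      group
  have h1 := key n
  have hs : A.s n = A.s 0 := by simpa using A.s_add 0
  have hX : A.X n = w := by simpa [A.X_zero] using A.X_add 0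
  rw [hs, hX] at h1
  have h2 := hmin (τ.trans (MulAut.conj (l (A.s 0))⁻¹))
  simp only [MulEquiv.trans_apply, MulAut.conj_apply, inv_inv] at h2
  have h3 := Finset.sum_le_sum fun (m : ℕ) (_ : m ∈ Finset.range n) =>
    norm_whitehead_pair ha ha' (A.s_ne m)
  simp only [Finset.sum_add_distrib] at h3
  have h4 := periodCount_add_one (n := n) (p := fun m => A.s m ≠ invLetter a)
    (fun m => by rw [A.s_add])
  have h5 : (∑ m ∈ Finset.range n, if A.s m = invLetter a then 1 else 0) +
      periodCount n (fun m => A.s m ≠ invLetter a) = n := by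
    unfold periodCount
    rw [← Finset.sum_add_distrib]
    conv_rhs => rw [← Finset.card_range n, Finset.card_eq_sum_ones]
    refine Finset.sum_congr rfl fun m _ => ?_
    split_ifs <;> simp_all
  have h6 : ∑ m ∈ Finset.range n, norm (R (A.s m) * l (A.s (m + 1))) =
    ∑ m ∈ Finset.range n, norm (whiteheadRight P a (A.s m) * whiteheadLeft P a (A.s (m + 1))) := rfl
  have h7 : (∑ m ∈ Finset.range n, if A.s (m + 1) ≠ invLetter a then 1 else 0) =
      periodCount n (fun m => A.s (m + 1) ≠ invLetter a) := by
    unfold periodCount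
    congr!
  have h8 : (∑ m ∈ Finset.range n, if Meet P a (invLetter (A.s m)) (A.s (m + 1)) then 1 else 0) =
      periodCount n (fun m => Meet P a (invLetter (A.s m)) (A.s (m + 1))) := rfl
  have h9 : (∑ m ∈ Finset.range n, if Cut P a (invLetter (A.s m)) (A.s (m + 1)) then 1 else 0) =
      periodCount n (fun m => Cut P a (invLetter (A.s m)) (A.s (m + 1))) := rfl
  omega

end Whitehead

section Endgame

variable {α : Type*} [DecidableEq α] {w : FreeGroup α} {n : ℕ} (A : Axis w n)

namespace Axis

theorem s_congr {m m' : ℤ} (h : (n : ℤ) ∣ m - m') : A.s m = A.s m' := by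
  obtain ⟨k, hk⟩ := h
  rw [show m = m' + k * n by linarith [mul_comm k (n : ℤ)], A.s_add_mul]

/-- If the edges of the Whitehead graph of a word of minimal length can be separated by a cut
consisting of a single edge, then the word is a single letter. -/
theorem eq_one_of_cut (hmin : ∀ β : FreeGroup α ≃* FreeGroup α, n ≤ norm (β w))
    {P : Set (α × Bool)}
    (hP : periodCount n (fun m => Xor (invLetter (A.s m) ∈ P) (A.s (m + 1) ∈ P)) ≤ 1)
    (hex : ∃ m, Xor (invLetter (A.s m) ∈ P) (A.s (m + 1) ∈ P)) : n = 1 := by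
  have hn := A.pos
  have hs1 (m : ℤ) : A.s (m + n + 1) = A.s (m + 1) := by
    rw [show m + n + 1 = m + 1 + n by ring, A.s_add]
  obtain ⟨m₁, hm₁⟩ : ∃ m, ¬ (A.s m ∈ P ↔ invLetter (A.s m) ∈ P) := by
    by_contra! hcon
    obtain ⟨m, hm⟩ := hex
    have hpath (k : ℕ) (hk : k + 1 ≤ n) : A.s (m + 1 + k) ∈ P ↔ A.s (m + 1) ∈ P := by
      induction k with
      | zero => simp
      | succ k ih =>
        rw [← ih (by omega)]
        by_contra hne
        have hx : Xor (invLetter (A.s (m + 1 + k)) ∈ P) (A.s (m + 1 + k + 1) ∈ P) := by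
          rw [← hcon, xor_iff_not_iff]
          push_cast at hne
          rw [← add_assoc] at hne
          tauto
        have := dvd_sub_of_periodCount_le_one hn (fun m => by rw [A.s_add, hs1]) hP hx hm
        rw [show m + 1 + k - m = ((k + 1 : ℕ) : ℤ) by push_cast; ring, Int.natCast_dvd_natCast]
          at this
        exact absurd (Nat.le_of_dvd (by omega) this) (by omega)
    have h1 := hpath (n - 1) (by omega)
    rw [show m + 1 + ((n - 1 : ℕ) : ℤ) = m + n by omega, A.s_add, hcon] at h1
    rw [xor_iff_not_iff] at hm
    exact hm h1
  obtain ⟨b, hb, hb', m₀, hm₀⟩ : ∃ b, b ∈ P ∧ invLetter b ∉ P ∧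
      ∃ m, invLetter (A.s m) = b ∨ A.s (m + 1) = b := by
    by_cases h : A.s m₁ ∈ P
    · exact ⟨A.s m₁, h, by tauto, m₁ - 1, .inr (by simp)⟩
    · exact ⟨invLetter (A.s m₁), by tauto, by rwa [invLetter_invLetter], m₁, .inl rfl⟩
  have hW := A.periodCount_meet_le hmin (P := P \ {b}) (a := b) (by simp) (by simp [hb'])
  have hD : periodCount n (fun m => invLetter (A.s m) = b ∨ A.s (m + 1) = b) ≤ 1 := by
    let K : ℤ → Prop := fun m => (invLetter (A.s m) = b ∧ A.s (m + 1) ∉ P) ∨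
      (A.s (m + 1) = b ∧ invLetter (A.s m) ∉ P)
    have h1 : periodCount n (fun m => invLetter (A.s m) = b ∨ A.s (m + 1) = b) ≤
        periodCount n (fun m => Meet (P \ {b}) b (invLetter (A.s m)) (A.s (m + 1)) ∨ K m) := by
      refine periodCount_mono fun m hm => ?_
      have := A.s_ne m
      simp only [Meet, K, Set.mem_sdiff, Set.mem_singleton_iff]
      rcases hm with h | h
      · rw [h] at this ⊢
        tauto
      · rw [h] at this ⊢
        have := this.symm
        tauto
    have h2 := periodCount_add_le (n := n)
      (p := fun m => Cut (P \ {b}) b (invLetter (A.s m)) (A.s (m + 1))) (q := K)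
      (t := fun m => Xor (invLetter (A.s m) ∈ P) (A.s (m + 1) ∈ P))
      (fun m hm hK => by
        unfold Cut at hm
        simp only [K] at hK
        tauto)
      (fun m hm => by
        simp only [Cut, Set.mem_sdiff, Set.mem_singleton_iff, Xor] at hm ⊢
        tauto)
      (fun m hK => by
        simp only [K] at hK
        unfold Xor
        rcases hK with ⟨h, h'⟩ | ⟨h, h'⟩
        · rw [h]; tauto
        · rw [h]; tauto)
    exact h1.trans ((periodCount_or_le _ _).trans ((Nat.add_le_add_right hW _).trans
      (h2.trans hP)))
  have hDp : ∀ m : ℤ, (invLetter (A.s (m + n)) = b ∨ A.s (m + n + 1) = b) ↔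
      (invLetter (A.s m) = b ∨ A.s (m + 1) = b) := fun m => by rw [A.s_add, hs1]
  have hDd {m m' : ℤ} (h : invLetter (A.s m) = b ∨ A.s (m + 1) = b)
      (h' : invLetter (A.s m') = b ∨ A.s (m' + 1) = b) : (n : ℤ) ∣ m - m' :=
    dvd_sub_of_periodCount_le_one hn hDp hD h h'
  by_contra hn1
  have hnd : ¬ (n : ℤ) ∣ 1 := by
    rw [← Int.natCast_one, Int.natCast_dvd_natCast, Nat.dvd_one]
    exact hn1
  obtain ⟨z, hz, hz', hF⟩ : ∃ z, z ≠ b ∧ invLetter z ≠ b ∧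
      ((invLetter (A.s m₀) = b ∧ A.s (m₀ + 1) = z) ∨
        (invLetter (A.s m₀) = z ∧ A.s (m₀ + 1) = b)) := by
    have hne := A.s_ne m₀
    by_cases h : invLetter (A.s m₀) = b
    · refine ⟨_, ?_, ?_, .inl ⟨h, rfl⟩⟩
      · rwa [h] at hne
      · intro h'
        have := hDd (m := m₀ + 1) (m' := m₀) (.inl h') hm₀
        rw [add_sub_cancel_left] at this
        exact hnd this
    · have h1 := hm₀.resolve_left h
      refine ⟨_, h, ?_, .inr ⟨rfl, h1⟩⟩
      rw [invLetter_invLetter]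
      intro h'
      have := hDd (m := m₀) (m' := m₀ - 1) hm₀ (.inr (by rwa [sub_add_cancel]))
      rw [sub_sub_cancel] at this
      exact hnd this
  have hW' := A.periodCount_meet_le hmin (P := {b}) (a := z) (by simpa using hz)
    (by simpa using hz')
  have hM : periodCount n (fun m => Meet {b} z (invLetter (A.s m)) (A.s (m + 1))) ≠ 0 := by
    rw [ne_eq, periodCount_eq_zero_iff hn (fun m => by rw [A.s_add, hs1])]
    intro h
    apply h m₀
    simp only [Meet, Set.mem_singleton_iff]
    tauto
  have hC : periodCount n (fun m => Cut {b} z (invLetter (A.s m)) (A.s (m + 1))) = 0 := by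
    rw [periodCount_eq_zero_iff hn (fun m => by rw [A.s_add, hs1])]
    rintro m ⟨h1, h2, h3⟩
    have hd := hDd (m := m) (m' := m₀) (by
      simp only [Set.mem_singleton_iff, Xor] at h3; tauto) hm₀
    have e1 := A.s_congr hd
    have e2 := A.s_congr (m := m + 1) (m' := m₀ + 1) (by rwa [add_sub_add_right_eq_sub])
    rw [e1] at h1
    rw [e2] at h2
    tauto
  omega

end Axis

end Endgame

section Ends

variable {α : Type*}

/-- The vertices of the Cayley tree at which the colouring `c` is not locally constant. -/
def boundary (c : FreeGroup α → Bool) : Set (FreeGroup α) := {g | ∃ y, c (g * mk [y]) ≠ c g}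

/-- The translate by `h` of the axis of `w` has ends of colours `p` and `q`. -/
def Axis.EndColors {w : FreeGroup α} {n : ℕ} (A : Axis w n) (c : FreeGroup α → Bool)
    (h : FreeGroup α) (p q : Bool) : Prop :=
  ∃ M : ℤ, ∀ k ≥ M, c (h * A.X k) = p ∧ c (h * A.X (-k)) = q

/-- The ends of the translate by `h` of the axis of `w` have distinct colours. -/
def Axis.Bad {w : FreeGroup α} {n : ℕ} (A : Axis w n) (c : FreeGroup α → Bool)
    (h : FreeGroup α) : Prop :=
  ∃ p q, A.EndColors c h p q ∧ p ≠ q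

theorem Axis.EndColors.bad_iff {w : FreeGroup α} {n : ℕ} {A : Axis w n} {c : FreeGroup α → Bool}
    {h : FreeGroup α} {p q : Bool} (H : A.EndColors c h p q) : A.Bad c h ↔ p ≠ q := by
  refine ⟨?_, fun h => ⟨p, q, H, h⟩⟩
  rintro ⟨p', q', ⟨M', h'⟩, hne⟩
  obtain ⟨M, h⟩ := H
  have h1 := h (max M M') (le_max_left _ _)
  have h2 := h' (max M M') (le_max_right _ _)
  rw [← h1.1, ← h1.2, h2.1, h2.2]
  exact hne

theorem Axis.bad_congr {w : FreeGroup α} {n : ℕ} {A : Axis w n} {c c' : FreeGroup α → Bool}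
    {h : FreeGroup α} (hc : ∀ m, c (h * A.X m) = c' (h * A.X m)) : A.Bad c h ↔ A.Bad c' h := by
  simp only [Axis.Bad, Axis.EndColors, hc]

theorem Axis.not_bad_of_const {w : FreeGroup α} {n : ℕ} {A : Axis w n} {c : FreeGroup α → Bool}
    {h : FreeGroup α} (p : Bool) (hc : ∀ m, c (h * A.X m) = p) : ¬ A.Bad c h := by
  have : A.EndColors c h p p := ⟨0, fun k _ => ⟨hc _, hc _⟩⟩
  rw [this.bad_iff]
  simp

variable [DecidableEq α]

namespace Axis

variable {w : FreeGroup α} {n : ℕ} (A : Axis w n)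

theorem exists_endColors {c : FreeGroup α → Bool} (hc : (boundary c).Finite) (h : FreeGroup α) :
    ∃ p q, A.EndColors c h p q := by
  have hfin : {k : ℤ | h * A.X k ∈ boundary c}.Finite :=
    hc.preimage (Function.Injective.injOn ((mul_right_injective h).comp A.X_injective))
  obtain ⟨M, hM⟩ : ∃ M : ℤ, ∀ k ∈ {k : ℤ | h * A.X k ∈ boundary c}, |k| < M := by
    obtain ⟨M, hM⟩ := (hfin.image fun k => |k|).bddAbove
    exact ⟨M + 1, fun k hk => Int.lt_add_one_of_le (hM ⟨k, hk, rfl⟩)⟩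
  have hstep (k : ℤ) (hk : M ≤ |k|) : c (h * A.X (k + 1)) = c (h * A.X k) := by
    by_contra hne
    refine absurd (hM k ⟨A.s k, ?_⟩) (not_lt.2 hk)
    rwa [mul_assoc, ← A.X_succ]
  refine ⟨c (h * A.X (max M 0)), c (h * A.X (-(max M 0))), max M 0, fun k hk => ?_⟩
  induction k, hk using Int.leInduction with
  | base => exact ⟨rfl, rfl⟩
  | succ k hk ih =>
    have h0 : 0 ≤ k := (le_max_right _ _).trans hk
    have h1 : M ≤ k := (le_max_left _ _).trans hk
    refine ⟨?_, ?_⟩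
    · rw [hstep _ (by rwa [abs_of_nonneg h0]), ih.1]
    · have := hstep (-(k + 1)) (by rw [abs_neg, abs_of_nonneg (by omega)]; omega)
      rw [← this, ← ih.2]
      congr 3
      ring

theorem dir_const {v h : FreeGroup α} (hv : ∀ m, h * A.X m ≠ v) (m : ℤ) :
    dir v (h * A.X m) = dir v (h * A.X 0) := by
  have hstep (m : ℤ) : dir v (h * A.X (m + 1)) = dir v (h * A.X m) := by
    have := hv (m + 1)
    rw [A.X_succ, ← mul_assoc] at this ⊢
    exact dir_mul_letter (hv m) this
  induction m using Int.induction_on with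
  | zero => rfl
  | succ k ih => rw [hstep, ih]
  | pred k ih =>
    have := hstep (-k - 1)
    rw [sub_add_cancel] at this
    rw [← this, ih]

/-- The translates of the axis through `v` leave `v` through the two letters of a pass. -/
theorem dir_through (v : FreeGroup α) (m : ℤ) :
    (∀ k > m + 1, dir v (v * (A.X (m + 1))⁻¹ * A.X k) = some (A.s (m + 1))) ∧
      ∀ k < m + 1, dir v (v * (A.X (m + 1))⁻¹ * A.X k) = some (invLetter (A.s m)) := by
  have h (k : ℤ) : dir v (v * (A.X (m + 1))⁻¹ * A.X k) = dir (A.X (m + 1)) (A.X k) := by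
    rw [← dir_mul_left (v * (A.X (m + 1))⁻¹) (A.X (m + 1)), inv_mul_cancel_right]
  refine ⟨fun k hk => ?_, fun k hk => ?_⟩
  · rw [h, A.dir_fwd hk]
  · rw [h, A.dir_bwd hk, add_sub_cancel_right]

theorem endColors_through {c : FreeGroup α → Bool} {v : FreeGroup α} {m : ℤ} {p q : Bool}
    (hp : ∃ M, ∀ k ≥ M, dir v (v * (A.X (m + 1))⁻¹ * A.X k) = some (A.s (m + 1)) →
      c (v * (A.X (m + 1))⁻¹ * A.X k) = p)
    (hq : ∃ M, ∀ k ≥ M, dir v (v * (A.X (m + 1))⁻¹ * A.X (-k)) = some (invLetter (A.s m)) →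
      c (v * (A.X (m + 1))⁻¹ * A.X (-k)) = q) :
    A.EndColors c (v * (A.X (m + 1))⁻¹) p q := by
  obtain ⟨M, hM⟩ := hp
  obtain ⟨N, hN⟩ := hq
  obtain ⟨h1, h2⟩ := A.dir_through v m
  refine ⟨max (max M N) (max (m + 2) (-m)), fun k hk => ?_⟩
  simp only [ge_iff_le, max_le_iff] at hk
  exact ⟨hM k hk.1.1 (h1 k (by omega)), hN k hk.1.2 (h2 (-k) (by omega))⟩

/-- Two passes through `v` at positions differing by a multiple of `n` lie on the same translate
of the axis. -/
theorem same_line_iff (v : FreeGroup α) (m m' : ℤ) :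
    (∃ k : ℤ, v * (A.X (m + 1))⁻¹ = v * (A.X (m' + 1))⁻¹ * w ^ k) ↔ (n : ℤ) ∣ m - m' := by
  have h (k : ℤ) : v * (A.X (m + 1))⁻¹ = v * (A.X (m' + 1))⁻¹ * w ^ k ↔ m' = m + k * n := by
    have h1 : v * (A.X (m + 1))⁻¹ = v * (A.X (m' + 1))⁻¹ * w ^ k ↔
        A.X (m' + 1) = w ^ k * A.X (m + 1) := by
      rw [mul_assoc, mul_right_inj, eq_inv_mul_iff_mul_eq, mul_inv_eq_iff_eq_mul]
    rw [h1, ← A.X_add_mul, A.X_injective.eq_iff]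
    constructor <;> intro h <;> linarith
  simp only [h]
  constructor
  · rintro ⟨k, rfl⟩
    exact ⟨-k, by ring⟩
  · rintro ⟨k, hk⟩
    exact ⟨-k, by linarith [mul_comm k (n : ℤ)]⟩

theorem dvd_sub_of_bad {c : FreeGroup α → Bool} {h₀ : FreeGroup α}
    (hU : ∀ h, A.Bad c h ↔ ∃ k : ℤ, h = h₀ * w ^ k) {v : FreeGroup α} {m m' : ℤ}
    (hm : A.Bad c (v * (A.X (m + 1))⁻¹)) (hm' : A.Bad c (v * (A.X (m' + 1))⁻¹)) :
    (n : ℤ) ∣ m - m' := by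
  obtain ⟨k, hk⟩ := (hU _).1 hm
  obtain ⟨k', hk'⟩ := (hU _).1 hm'
  rw [← A.same_line_iff v]
  refine ⟨k - k', ?_⟩
  rw [hk, hk', mul_assoc, ← zpow_add]
  congr 2
  ring

end Axis

end Ends

section Prune

variable {α : Type*} [DecidableEq α] {w : FreeGroup α} {n : ℕ} (A : Axis w n)

/-- The colouring obtained from `c` by giving the colour `p` to `v` and all the branches at `v`
except for the one at `a`. -/
def prune (c : FreeGroup α → Bool) (v : FreeGroup α) (a : α × Bool) (p : Bool)
    (u : FreeGroup α) : Bool :=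
  if dir v u = some a then c u else p

theorem boundary_prune_finite [Finite α] {c : FreeGroup α → Bool} (hc : (boundary c).Finite)
    (v : FreeGroup α) (a : α × Bool) (p : Bool) : (boundary (prune c v a p)).Finite := by
  refine ((hc.union (Set.finite_singleton v)).union
    (Set.finite_range fun y : α × Bool => v * mk [y])).subset ?_
  rintro u ⟨y, hy⟩
  by_cases h1 : u = v
  · exact .inl (.inr h1)
  by_cases h2 : u * mk [y] = v
  · refine .inr ⟨invLetter y, ?_⟩
    simp only
    rw [← h2, mk_invLetter, mul_inv_cancel_right]
  · refine .inl (.inl ⟨y, ?_⟩)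
    unfold prune at hy
    rw [dir_mul_letter h1 h2] at hy
    split_ifs at hy
    · exact hy
    · exact absurd rfl hy

variable {c : FreeGroup α → Bool} {v : FreeGroup α} {a : α × Bool} {p : Bool} {γ : α × Bool → Bool}

theorem Axis.bad_prune_of_not_through (hγ : ∀ y ≠ a, ∀ u, dir v u = some y → c u = γ y)
    {h : FreeGroup α} (hv : ∀ m, h * A.X m ≠ v) : A.Bad (prune c v a p) h ↔ A.Bad c h := by
  have hd := A.dir_const hv
  by_cases ha : dir v (h * A.X 0) = some a
  · exact Axis.bad_congr fun m => by rw [prune, if_pos (by rw [hd, ha])]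
  · obtain ⟨y, hy⟩ : ∃ y, dir v (h * A.X 0) = some y := by
      rw [← Option.ne_none_iff_exists', ne_eq, dir_eq_none_iff]
      exact hv 0
    refine iff_of_false (Axis.not_bad_of_const p fun m => ?_)
      (Axis.not_bad_of_const (γ y) fun m => ?_)
    · rw [prune, if_neg (by rwa [hd])]
    · exact hγ y (by rintro rfl; exact ha hy) _ (by rw [hd, hy])

theorem Axis.bad_prune_through (hc : (boundary c).Finite)
    (hγ : ∀ y ≠ a, ∀ u, dir v u = some y → c u = γ y) {P : Set (α × Bool)}
    (hP : ∀ y, y ∈ P ↔ y ≠ a ∧ γ y ≠ p) (m : ℤ) :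
    (Cut P a (invLetter (A.s m)) (A.s (m + 1)) →
      A.Bad c (v * (A.X (m + 1))⁻¹) ∧ ¬ A.Bad (prune c v a p) (v * (A.X (m + 1))⁻¹)) ∧
    (Meet P a (invLetter (A.s m)) (A.s (m + 1)) →
      (A.Bad (prune c v a p) (v * (A.X (m + 1))⁻¹) ↔ ¬ A.Bad c (v * (A.X (m + 1))⁻¹))) ∧
    (¬ Cut P a (invLetter (A.s m)) (A.s (m + 1)) → ¬ Meet P a (invLetter (A.s m)) (A.s (m + 1)) →
      (A.Bad (prune c v a p) (v * (A.X (m + 1))⁻¹) ↔ A.Bad c (v * (A.X (m + 1))⁻¹))) := by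
  obtain ⟨p₀, q₀, M, hM⟩ := A.exists_endColors hc (v * (A.X (m + 1))⁻¹)
  have hne := A.s_ne m
  have hcol : ∀ y u, dir v u = some y → c u = if y = a then c u else γ y := by
    intro y u hu
    split_ifs with h
    · rfl
    · exact hγ y h u hu
  have hcol' : ∀ y u, dir v u = some y → prune c v a p u = if y = a then c u else p := by
    intro y u hu
    unfold prune
    rw [hu]
    simp
  have e1 : A.EndColors c (v * (A.X (m + 1))⁻¹)
      (if A.s (m + 1) = a then p₀ else γ (A.s (m + 1)))
      (if invLetter (A.s m) = a then q₀ else γ (invLetter (A.s m))) :=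
    A.endColors_through ⟨M, fun k hk h => by rw [hcol _ _ h, (hM k hk).1]⟩
      ⟨M, fun k hk h => by rw [hcol _ _ h, (hM k hk).2]⟩
  have e2 : A.EndColors (prune c v a p) (v * (A.X (m + 1))⁻¹)
      (if A.s (m + 1) = a then p₀ else p)
      (if invLetter (A.s m) = a then q₀ else p) :=
    A.endColors_through ⟨M, fun k hk h => by rw [hcol' _ _ h, (hM k hk).1]⟩
      ⟨M, fun k hk h => by rw [hcol' _ _ h, (hM k hk).2]⟩
  rw [e1.bad_iff, e2.bad_iff]
  unfold Cut Meet
  rw [hP, hP]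
  generalize invLetter (A.s m) = x at *
  generalize A.s (m + 1) = y at *
  by_cases hx : x = a
  · subst hx
    cases p₀ <;> cases q₀ <;> cases p <;> cases γ y <;> simp [hne, Xor]
  · by_cases hy : y = a
    · subst hy
      cases p₀ <;> cases q₀ <;> cases p <;> cases γ x <;> simp [hx, Xor]
    · cases p <;> cases γ x <;> cases γ y <;> simp [hx, hy, Xor]

end Prune

section Descent

variable {α : Type*} [DecidableEq α]

/-- The nontrivial elements on whose cone `c` is not constant. -/
def mixedCones (c : FreeGroup α → Bool) : Set (FreeGroup α) :=
  {v | v ≠ 1 ∧ ∃ u ∈ cone v, ∃ u' ∈ cone v, c u ≠ c u'}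

theorem eq_of_mem_cone_of_disjoint_boundary {c : FreeGroup α → Bool} {v : FreeGroup α}
    (hv : ∀ g ∈ boundary c, g ∉ cone v) {u : FreeGroup α} (hu : u ∈ cone v) : c u = c v := by
  obtain ⟨N, hN⟩ := hu
  induction N using List.reverseRecOn generalizing u with
  | nil => exact congrArg c (toWord_injective (by simpa using hN.symm))
  | append_singleton N y ih =>
    have hr : IsReduced (v.toWord ++ N) := by
      have : IsReduced u.toWord := isReduced_toWord
      rw [← hN] at this
      exact this.infix ⟨[], [y], by simp⟩
    have hw : (mk (v.toWord ++ N)).toWord = v.toWord ++ N := by rw [toWord_mk, hr.reduce_eq]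
    have huw : u = mk (v.toWord ++ N) * mk [y] := by
      rw [mul_mk, List.append_assoc, hN, mk_toWord]
    rw [← ih hw.symm, huw]
    by_contra hne
    exact hv _ ⟨y, hne⟩ ⟨N, hw.symm⟩

theorem mixedCones_finite {c : FreeGroup α → Bool} (hc : (boundary c).Finite) :
    (mixedCones c).Finite := by
  have hfin : (⋃ g ∈ boundary c, {v : FreeGroup α | v.toWord <+: g.toWord}).Finite := by
    refine hc.biUnion fun g _ => ?_
    have : ({L | L ∈ g.toWord.inits} : Set (List (α × Bool))).Finite := List.finite_toSet _
    refine (this.preimage toWord_injective.injOn).subset fun v hv => ?_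
    simpa using hv
  refine hfin.subset ?_
  rintro v ⟨-, u, hu, u', hu', hne⟩
  by_contra hcon
  simp only [Set.mem_iUnion, not_exists] at hcon
  have h := fun g hg hg' => hcon g hg hg'
  exact hne ((eq_of_mem_cone_of_disjoint_boundary h hu).trans
    (eq_of_mem_cone_of_disjoint_boundary h hu').symm)

theorem exists_mixed_max {c : FreeGroup α → Bool} (hc : (boundary c).Finite)
    (hne : (mixedCones c).Nonempty) : ∃ v L b, v ∈ mixedCones c ∧ v.toWord = L ++ [b] ∧
      ∀ y ≠ invLetter b, ∀ u, dir v u = some y → c u = c (v * mk [y]) := by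
  obtain ⟨v, hv, hmax⟩ := (mixedCones_finite hc).exists_maximalFor norm _ hne
  have hv1 : v.toWord ≠ [] := fun h => hv.1 (toWord_eq_nil_iff.1 h)
  obtain ⟨L, b, hL⟩ := (List.eq_nil_or_concat v.toWord).resolve_left hv1
  rw [List.concat_eq_append] at hL
  refine ⟨v, L, b, hv, hL, fun y hy u hu => ?_⟩
  by_contra hcon
  have hw := toWord_mul_letter_of_ne hL hy
  have hmem : v * mk [y] ∈ mixedCones c := by
    refine ⟨fun h => ?_, u, mem_cone_mul_letter hL hy hu, _, mem_cone_self _, hcon⟩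
    rw [h] at hw
    simp at hw
  have := hmax hmem
  simp only [norm, hw, List.length_append, List.length_singleton] at this
  omega

theorem mixedCones_prune_ssubset {c : FreeGroup α → Bool} {v : FreeGroup α}
    {L : List (α × Bool)} {b : α × Bool} (hv : v ∈ mixedCones c) (hL : v.toWord = L ++ [b]) :
    mixedCones (prune c v (invLetter b) (c (v * mk [b]))) ⊂ mixedCones c := by
  have hin {u : FreeGroup α} (hu : u ∈ cone v) :
      prune c v (invLetter b) (c (v * mk [b])) u = c (v * mk [b]) := by
    rw [prune, if_neg ((mem_cone_iff hL u).1 hu)]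
  have hout {u : FreeGroup α} (hu : u ∉ cone v) :
      prune c v (invLetter b) (c (v * mk [b])) u = c u := by
    rw [mem_cone_iff hL, not_not] at hu
    rw [prune, if_pos hu]
  have hmix {x u u' : FreeGroup α} (hu : u ∈ cone x) (hu' : u' ∈ cone x) (huv : u ∈ cone v)
      (huv' : u' ∉ cone v) : v * mk [b] ∈ cone x := by
    rcases List.prefix_or_prefix_of_prefix hu huv with h | h
    · unfold cone
      rw [Set.mem_ofPred_eq, toWord_mul_letter_of_ne hL (invLetter_ne b).symm]
      exact h.trans (List.prefix_append _ _)
    · exact absurd (h.trans hu') huv'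
  refine (Set.ssubset_iff_of_subset ?_).2 ⟨v, hv, ?_⟩
  · rintro x ⟨hx, u, hu, u', hu', hne⟩
    refine ⟨hx, ?_⟩
    by_cases h : u ∈ cone v <;> by_cases h' : u' ∈ cone v
    · rw [hin h, hin h'] at hne
      exact absurd rfl hne
    · rw [hin h, hout h'] at hne
      exact ⟨_, hmix hu hu' h h', u', hu', hne⟩
    · rw [hout h, hin h'] at hne
      exact ⟨u, hu, _, hmix hu' hu h' h, hne⟩
    · rw [hout h, hout h'] at hne
      exact ⟨u, hu, u', hu', hne⟩
  · rintro ⟨-, u, hu, u', hu', hne⟩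
    rw [hin hu, hin hu'] at hne
    exact hne rfl

variable [Finite α] {w : FreeGroup α} {n : ℕ} (A : Axis w n)

/-- If the translates of the axis of `w` with ends of distinct colours form a single coset of
the cyclic group generated by `w`, and `w` has minimal length, then it is a letter. -/
theorem Axis.eq_one_of_bad_unique
    (hmin : ∀ β : FreeGroup α ≃* FreeGroup α, n ≤ norm (β w)) {c : FreeGroup α → Bool}
    (hc : (boundary c).Finite) {h₀ : FreeGroup α}
    (hU : ∀ h, A.Bad c h ↔ ∃ k : ℤ, h = h₀ * w ^ k) : n = 1 := by
  have hn := A.pos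
  have hs1 (m : ℤ) : A.s (m + n + 1) = A.s (m + 1) := by
    rw [show m + n + 1 = m + 1 + n by ring, A.s_add]
  have hper {Q : α × Bool → α × Bool → Prop} (m : ℤ) :
      Q (invLetter (A.s (m + n))) (A.s (m + n + 1)) ↔ Q (invLetter (A.s m)) (A.s (m + 1)) := by
    rw [A.s_add, hs1]
  have hcongr {m m' : ℤ} (h : (n : ℤ) ∣ m - m') {Q : α × Bool → α × Bool → Prop}
      (hQ : Q (invLetter (A.s m)) (A.s (m + 1))) : Q (invLetter (A.s m')) (A.s (m' + 1)) := by
    rwa [← A.s_congr h, ← A.s_congr (m := m + 1) (m' := m' + 1) (by rwa [add_sub_add_right_eq_sub])]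
  have hthrough {v h : FreeGroup α} (hv : ¬ ∀ m, h * A.X m ≠ v) :
      ∃ m, h = v * (A.X (m + 1))⁻¹ := by
    push Not at hv
    obtain ⟨m, hm⟩ := hv
    exact ⟨m - 1, by rw [sub_add_cancel, ← hm, mul_inv_cancel_right]⟩
  induction hN : (mixedCones c).ncard using Nat.strong_induction_on generalizing c h₀ with
  | _ N ih =>
  have hbad₀ : A.Bad c h₀ := (hU h₀).2 ⟨0, by simp⟩
  rcases (mixedCones c).eq_empty_or_nonempty with hT | hT
  · have hγ (y : α × Bool) (u : FreeGroup α) (hu : dir 1 u = some y) :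
        c u = c (FreeGroup.mk [y]) := by
      by_contra hne
      have : FreeGroup.mk [y] ∈ mixedCones c := by
        refine ⟨fun h => ?_, u, ?_, _, mem_cone_self _, hne⟩
        · simpa [toWord_mk] using congrArg toWord h
        · unfold cone
          unfold dir at hu
          rw [inv_one, one_mul] at hu
          cases hL : u.toWord with
          | nil => simp [hL] at hu
          | cons t M =>
            rw [hL] at hu
            simp only [List.head?_cons, Option.some.injEq] at hu
            rw [Set.mem_ofPred_eq, hL, toWord_mk, reduce_singleton, hu]
            exact ⟨M, rfl⟩
      rw [hT] at this
      exact this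
    have hth (m : ℤ) : A.Bad c (1 * (A.X (m + 1))⁻¹) ↔
        Xor (invLetter (A.s m) ∈ {y | c (FreeGroup.mk [y]) = true})
          (A.s (m + 1) ∈ {y | c (FreeGroup.mk [y]) = true}) := by
      have e : A.EndColors c (1 * (A.X (m + 1))⁻¹) (c (FreeGroup.mk [A.s (m + 1)]))
          (c (FreeGroup.mk [invLetter (A.s m)])) :=
        A.endColors_through ⟨0, fun k _ h => hγ _ _ h⟩ ⟨0, fun k _ h => hγ _ _ h⟩
      rw [e.bad_iff, Set.mem_ofPred_eq, Set.mem_ofPred_eq]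
      generalize c (FreeGroup.mk [A.s (m + 1)]) = p
      generalize c (FreeGroup.mk [invLetter (A.s m)]) = q
      cases p <;> cases q <;> simp [Xor]
    refine A.eq_one_of_cut hmin (P := {y | c (FreeGroup.mk [y]) = true})
      (periodCount_le_one_of_dvd fun m m' hm hm' => ?_) ?_
    · exact A.dvd_sub_of_bad hU ((hth m).2 hm) ((hth m').2 hm')
    · by_cases hv : ∀ m, h₀ * A.X m ≠ 1
      · exfalso
        obtain ⟨y, hy⟩ : ∃ y, dir 1 (h₀ * A.X 0) = some y := by
          rw [← Option.ne_none_iff_exists', ne_eq, dir_eq_none_iff]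
          exact hv 0
        exact Axis.not_bad_of_const _ (fun m => hγ y _ (by rw [A.dir_const hv, hy])) hbad₀
      · obtain ⟨m, hm⟩ := hthrough hv
        exact ⟨m, (hth m).1 (hm ▸ hbad₀)⟩
  · obtain ⟨v, L, b, hv, hL, hγ⟩ := exists_mixed_max hc hT
    set c' := prune c v (invLetter b) (c (v * FreeGroup.mk [b])) with hc'
    have hlt : (mixedCones c').ncard < N := by
      rw [← hN]
      exact Set.ncard_lt_ncard (mixedCones_prune_ssubset hv hL) (mixedCones_finite hc)
    have hfin' : (boundary c').Finite := boundary_prune_finite hc _ _ _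
    set P : Set (α × Bool) :=
      {y | y ≠ invLetter b ∧ c (v * FreeGroup.mk [y]) ≠ c (v * FreeGroup.mk [b])} with hP
    have haP : invLetter b ∉ P := fun h => h.1 rfl
    have haP' : invLetter (invLetter b) ∉ P := fun h => h.2 (by rw [invLetter_invLetter])
    have hle := A.periodCount_meet_le hmin haP haP'
    have hthr := A.bad_prune_through (P := P) (p := c (v * FreeGroup.mk [b])) hc hγ
      (fun y => Iff.rfl)
    have hnot {h : FreeGroup α} (hv : ∀ m, h * A.X m ≠ v) : A.Bad c' h ↔ A.Bad c h :=
      A.bad_prune_of_not_through hγ hv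
    by_cases hE : ∃ m, Cut P (invLetter b) (invLetter (A.s m)) (A.s (m + 1))
    · obtain ⟨m₀, hm₀⟩ := hE
      have hg₀ := ((hthr m₀).1 hm₀).1
      have hE1 := periodCount_le_one_of_dvd
        (p := fun m => Cut P (invLetter b) (invLetter (A.s m)) (A.s (m + 1)))
        fun m m' hm hm' => A.dvd_sub_of_bad hU ((hthr m).1 hm).1 ((hthr m').1 hm').1
      have hdisj {m : ℤ} (hE : Cut P (invLetter b) (invLetter (A.s m)) (A.s (m + 1)))
          (hF : Meet P (invLetter b) (invLetter (A.s m)) (A.s (m + 1))) : False := by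
        unfold Cut at hE
        unfold Meet at hF
        tauto
      by_cases hF : ∃ m, Meet P (invLetter b) (invLetter (A.s m)) (A.s (m + 1))
      · obtain ⟨m₁, hm₁⟩ := hF
        have hFd {m m' : ℤ} (hm : Meet P (invLetter b) (invLetter (A.s m)) (A.s (m + 1)))
            (hm' : Meet P (invLetter b) (invLetter (A.s m')) (A.s (m' + 1))) :
            (n : ℤ) ∣ m - m' :=
          dvd_sub_of_periodCount_le_one hn
            (p := fun m => Meet P (invLetter b) (invLetter (A.s m)) (A.s (m + 1))) hper
            (hle.trans hE1) hm hm'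
        have hEbad {m : ℤ} (hm : A.Bad c (v * (A.X (m + 1))⁻¹)) :
            Cut P (invLetter b) (invLetter (A.s m)) (A.s (m + 1)) :=
          hcongr (A.dvd_sub_of_bad hU hg₀ hm) (Q := fun x y => Cut P (invLetter b) x y) hm₀
        refine ih _ hlt hfin' (h₀ := v * (A.X (m₁ + 1))⁻¹) (fun h => ?_) rfl
        by_cases hh : ∀ m, h * A.X m ≠ v
        · rw [hnot hh]
          have hline (m k : ℤ) (e : h = v * (A.X (m + 1))⁻¹ * w ^ k) : False := by
            apply hh (m + 1 + -k * n)
            rw [A.X_add_mul, e]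
            group
          refine iff_of_false (fun hbad => ?_) (fun ⟨k, hk⟩ => hline _ _ hk)
          obtain ⟨k, hk⟩ := (hU _).1 hbad
          obtain ⟨k₀, hk₀⟩ := (hU _).1 hg₀
          refine hline m₀ (-k₀ + k) ?_
          rw [hk₀, hk, mul_assoc, ← zpow_add]
          congr 2
          ring
        · obtain ⟨m, rfl⟩ := hthrough hh
          rw [A.same_line_iff]
          have hR (hd : (n : ℤ) ∣ m - m₁) :
              Meet P (invLetter b) (invLetter (A.s m)) (A.s (m + 1)) :=
            hcongr (by rwa [dvd_sub_comm]) (Q := fun x y => Meet P (invLetter b) x y) hm₁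
          by_cases hmF : Meet P (invLetter b) (invLetter (A.s m)) (A.s (m + 1))
          · rw [hc', (hthr m).2.1 hmF]
            exact iff_of_true (fun hb => hdisj (hEbad hb) hmF) (hFd hmF hm₁)
          · by_cases hmE : Cut P (invLetter b) (invLetter (A.s m)) (A.s (m + 1))
            · exact iff_of_false ((hthr m).1 hmE).2 fun hd => hmF (hR hd)
            · rw [hc', (hthr m).2.2 hmE hmF]
              exact iff_of_false (fun hb => hmE (hEbad hb)) fun hd => hmF (hR hd)
      · have hXE (m : ℤ) : Xor (invLetter (A.s m) ∈ P) (A.s (m + 1) ∈ P) ↔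
            Cut P (invLetter b) (invLetter (A.s m)) (A.s (m + 1)) := by
          refine ⟨fun hx => ⟨fun h => ?_, fun h => ?_, hx⟩, fun h => h.2.2⟩
          · refine hF ⟨m, .inl ⟨h, ?_⟩⟩
            rw [h] at hx
            unfold Xor at hx
            tauto
          · refine hF ⟨m, .inr ⟨h, ?_⟩⟩
            rw [h] at hx
            unfold Xor at hx
            tauto
        refine A.eq_one_of_cut hmin (P := P) ?_ ⟨m₀, (hXE m₀).2 hm₀⟩
        simpa only [hXE] using hE1
    · have hE0 : periodCount n
          (fun m => Cut P (invLetter b) (invLetter (A.s m)) (A.s (m + 1))) = 0 := by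
        rw [periodCount_eq_zero_iff hn hper]
        exact fun m hm => hE ⟨m, hm⟩
      have hF0 := (periodCount_eq_zero_iff hn
        (p := fun m => Meet P (invLetter b) (invLetter (A.s m)) (A.s (m + 1))) hper).1
        (Nat.le_zero.1 (hle.trans_eq hE0))
      refine ih _ hlt hfin' (h₀ := h₀) (fun h => ?_) rfl
      rw [← hU]
      by_cases hh : ∀ m, h * A.X m ≠ v
      · exact hnot hh
      · obtain ⟨m, rfl⟩ := hthrough hh
        exact (hthr m).2.2 (fun hm => hE ⟨m, hm⟩) (hF0 m)

end Descent

section Primitive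

variable {α : Type*}

/-- The colour changes of `φ` under right multiplication by any fixed element are finite in number
as soon as this holds for the generators. -/
theorem finite_mul_right_ne {β : Type*} {φ : FreeGroup α → β}
    (hφ : ∀ i, {h | φ (h * of i) ≠ φ h}.Finite) (g : FreeGroup α) :
    {h | φ (h * g) ≠ φ h}.Finite := by
  induction g using FreeGroup.induction_on with
  | C1 => simp
  | of i => exact hφ i
  | inv_of i _ =>
    refine ((hφ i).preimage (mul_left_injective (of i)⁻¹).injOn).subset fun h hh => ?_
    simpa using Ne.symm hh
  | mul x y hx hy =>
    refine (hx.union (hy.preimage (mul_left_injective x).injOn)).subset fun h hh => ?_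
    by_contra hcon
    simp only [Set.mem_union, Set.mem_ofPred_eq, Set.mem_preimage, not_or, not_not] at hcon
    exact hh (by rw [← mul_assoc, hcon.2, hcon.1])

theorem exists_equiv_of_eq_mk (i₀ : α) (s : α × Bool) :
    ∃ γ : FreeGroup α ≃* FreeGroup α, γ (of i₀) = mk [s] := by
  classical
  obtain ⟨i, b⟩ := s
  let f : FreeGroup α →* FreeGroup α := lift fun j => (of j)⁻¹
  have hf : f.comp f = MonoidHom.id _ := by
    ext j
    simp [f]
  cases b
  · refine ⟨(freeGroupCongr (Equiv.swap i₀ i)).trans (f.toMulEquiv f hf hf), ?_⟩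
    simp [f, freeGroupCongr]
    rfl
  · refine ⟨freeGroupCongr (Equiv.swap i₀ i), ?_⟩
    simp [freeGroupCongr]
    rfl

variable [DecidableEq α]

theorem exists_minimal_conj (w₀ : FreeGroup α) : ∃ β : FreeGroup α ≃* FreeGroup α,
    IsCyclicallyReduced (β w₀).toWord ∧
      ∀ β' : FreeGroup α ≃* FreeGroup α, norm (β w₀) ≤ norm (β' (β w₀)) := by
  classical
  have hex : ∃ m, ∃ β : FreeGroup α ≃* FreeGroup α, norm (β w₀) = m := ⟨_, MulEquiv.refl _, rfl⟩
  obtain ⟨β, hβ⟩ := Nat.find_spec hex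
  have hmin (β' : FreeGroup α ≃* FreeGroup α) : Nat.find hex ≤ norm (β' w₀) :=
    Nat.find_min' hex ⟨β', rfl⟩
  set L := (β w₀).toWord with hL
  have hred := reduceCyclically.isCyclicallyReduced (L := L) isReduced_toWord
  have hdec := reduceCyclically.conj_conjugator_reduceCyclically L
  let β₁ := β.trans (MulAut.conj (mk (reduceCyclically.conjugator L))⁻¹)
  have hβ₁ : β₁ w₀ = mk (reduceCyclically L) := by
    have h1 : β w₀ = mk (reduceCyclically.conjugator L) * mk (reduceCyclically L) *
        (mk (reduceCyclically.conjugator L))⁻¹ := by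
      rw [inv_mk, mul_mk, mul_mk, hdec, hL, mk_toWord]
    simp only [β₁, MulEquiv.trans_apply, MulAut.conj_apply, h1]
    group
  refine ⟨β₁, ?_, fun β' => ?_⟩
  · rw [hβ₁, toWord_mk, hred.isReduced.reduce_eq]
    exact hred
  · refine le_trans ?_ (hmin (β₁.trans β'))
    rw [hβ₁, ← hβ]
    refine norm_mk_le.trans ?_
    change _ ≤ L.length
    have := congrArg List.length hdec
    simp only [List.length_append] at this
    omega

theorem Axis.bad_iff_of_almost_invariant {w : FreeGroup α} {n : ℕ} (A : Axis w n)
    {φ : FreeGroup α → ZMod 2} (hw : ∀ h, φ (h * w) = φ h + if h = 1 then 1 else 0)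
    (hfin : (boundary fun h => decide (φ h = 0)).Finite) (h : FreeGroup α) :
    A.Bad (fun h => decide (φ h = 0)) h ↔ ∃ k : ℤ, h = 1 * w ^ k := by
  have hXn (t : ℤ) : A.X (t * n) = w ^ t := by
    simpa [A.X_zero] using A.X_add_mul 0 t
  have hpow {t : ℤ} (ht : w ^ t = 1) : t = 0 := by
    rw [← hXn, ← A.X_zero, A.X_injective.eq_iff] at ht
    exact (mul_eq_zero.1 ht).resolve_right (by exact_mod_cast A.pos.ne')
  have hstep (h : FreeGroup α) (t : ℤ) (ht : h * w ^ t ≠ 1) :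
      φ (h * w ^ (t + 1)) = φ (h * w ^ t) := by
    rw [zpow_add_one, ← mul_assoc, hw, if_neg ht, add_zero]
  obtain ⟨p, q, H⟩ := A.exists_endColors hfin h
  rw [H.bad_iff]
  obtain ⟨M, hM⟩ := H
  have hlarge (t : ℤ) (ht : max M 0 ≤ t) :
      decide (φ (h * w ^ t) = 0) = p ∧ decide (φ (h * w ^ (-t)) = 0) = q := by
    have hn : (1 : ℤ) ≤ n := by exact_mod_cast A.pos
    have h0 : 0 ≤ t := (le_max_right _ _).trans ht
    have h1 : M ≤ t := (le_max_left _ _).trans ht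
    have := hM (t * n) (by nlinarith)
    rwa [← neg_mul, hXn, hXn] at this
  by_cases hh : ∃ k : ℤ, h = 1 * w ^ k
  · refine iff_of_true ?_ hh
    obtain ⟨k, rfl⟩ := hh
    have hpos (t : ℕ) : φ (w ^ ((t : ℤ) + 1)) = φ w := by
      induction t with
      | zero => simp
      | succ t ih =>
        have := hstep 1 ((t + 1 : ℕ) : ℤ) (by
          rw [one_mul]
          exact fun h => absurd (hpow h) (by omega))
        rw [one_mul, one_mul] at this
        rw [this, ← ih]
        push_cast
        rfl
    have hneg (t : ℕ) : φ (w ^ (-(t : ℤ))) = φ 1 := by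
      induction t with
      | zero => simp
      | succ t ih =>
        have := hstep 1 (-((t + 1 : ℕ) : ℤ)) (by
          rw [one_mul]
          exact fun h => absurd (hpow h) (by omega))
        rw [one_mul, one_mul] at this
        rw [← this, ← ih]
        congr 2
        push_cast
        ring
    have hw1 : φ w = φ 1 + 1 := by simpa using hw 1
    obtain ⟨h1, h2⟩ := hlarge (max M 0 + |k| + 1) (by have := abs_nonneg k; omega)
    have hk1 := le_abs_self k
    have hk2 := neg_abs_le k
    have hM0 := le_max_right M 0
    obtain ⟨t₁, ht₁⟩ : ∃ t : ℕ, k + (max M 0 + |k| + 1) = (t : ℤ) + 1 :=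
      ⟨(k + (max M 0 + |k|)).toNat, by omega⟩
    obtain ⟨t₂, ht₂⟩ : ∃ t : ℕ, k + -(max M 0 + |k| + 1) = -(t : ℤ) :=
      ⟨(-(k + -(max M 0 + |k| + 1))).toNat, by omega⟩
    rw [one_mul, ← zpow_add, ht₁, hpos, hw1] at h1
    rw [one_mul, ← zpow_add, ht₂, hneg] at h2
    rw [← h1, ← h2]
    generalize φ 1 = x
    revert x
    decide
  · refine iff_of_false ?_ hh
    have hne (t : ℤ) : h * w ^ t ≠ 1 := by
      intro ht
      refine hh ⟨-t, ?_⟩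
      rw [one_mul, zpow_neg]
      exact eq_inv_of_mul_eq_one_left ht
    have hconst (t : ℤ) : φ (h * w ^ t) = φ h := by
      induction t using Int.induction_on with
      | zero => simp
      | succ t ih => rw [hstep _ _ (hne _), ih]
      | pred t ih =>
        have := hstep h (-t - 1) (hne _)
        rw [sub_add_cancel, ih] at this
        exact this.symm
    obtain ⟨h1, h2⟩ := hlarge (max M 0) le_rfl
    rw [hconst] at h1 h2
    rw [← h1, ← h2]
    simp

theorem exists_equiv_of_almost_invariant [Finite α] {w₀ : FreeGroup α}
    {φ : FreeGroup α → ZMod 2} (hφ : ∀ i, {h | φ (h * of i) ≠ φ h}.Finite)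
    (hw₀ : ∀ h, φ (h * w₀) = φ h + if h = 1 then 1 else 0) (i₀ : α) :
    ∃ γ : FreeGroup α ≃* FreeGroup α, γ (of i₀) = w₀ := by
  obtain ⟨β, hc, hmin⟩ := exists_minimal_conj w₀
  set w := β w₀ with hwβ
  let ψ : FreeGroup α → ZMod 2 := fun h => φ (β.symm h)
  have hψ (h : FreeGroup α) : ψ (h * w) = ψ h + if h = 1 then 1 else 0 := by
    simp only [ψ, hwβ, _root_.map_mul, MulEquiv.symm_apply_apply, hw₀, map_eq_one_iff β.symm
      β.symm.injective]
  have hψfin (g : FreeGroup α) : {h | ψ (h * g) ≠ ψ h}.Finite := by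
    refine ((finite_mul_right_ne hφ (β.symm g)).preimage β.symm.injective.injOn).subset ?_
    intro h hh
    simpa [ψ] using hh
  have hw1 : w ≠ 1 := by
    intro h
    have := hψ 1
    simp [h] at this
  obtain ⟨A⟩ := exists_axis hw1 hc
  have hfin : (boundary fun h => decide (ψ h = 0)).Finite := by
    refine (Set.finite_iUnion fun y : α × Bool => hψfin (mk [y])).subset ?_
    rintro g ⟨y, hy⟩
    refine Set.mem_iUnion.2 ⟨y, fun h => hy ?_⟩
    simp only [h]
  have hone := A.eq_one_of_bad_unique hmin hfin (A.bad_iff_of_almost_invariant hψ hfin)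
  obtain ⟨s, hs⟩ := List.length_eq_one_iff.1 (show w.toWord.length = 1 from hone)
  obtain ⟨γ, hγ⟩ := exists_equiv_of_eq_mk i₀ s
  refine ⟨γ.trans β.symm, ?_⟩
  rw [MulEquiv.trans_apply, hγ, ← hs, mk_toWord, hwβ, MulEquiv.symm_apply_apply]

end Primitive

end FreeGroup

/-- **Puder–Parzanchevski.** If `w ∈ F_r` induces the uniform measure on
every finite group (the pushforward of the uniform probability measure on `G^r` under the
word map of `w` is the uniform probability measure on `G`), then `w` is primitive, i.e.
`w` lies in the `Aut(F_r)`-orbit of the generator `x_1`. -/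
theorem primitive_of_uniform_on_finite_groups (r : ℕ) (hr : 1 ≤ r) (w : FreeGroup (Fin r))
    (h : ∀ (G : Type) [Group G] [Fintype G] [MeasurableSpace G]
        [MeasurableSingletonClass G],
        Measure.map (fun g : Fin r → G => FreeGroup.lift g w)
            ((Fintype.card (Fin r → G) : ENNReal)⁻¹ • Measure.count)
          = (Fintype.card G : ENNReal)⁻¹ • Measure.count) :
    ∃ α : FreeGroup (Fin r) ≃* FreeGroup (Fin r),
      α (FreeGroup.of (⟨0, hr⟩ : Fin r)) = w := by
  have hcard (G : Type) [Group G] [Finite G] (a b : G) :=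
    FreeGroup.card_fiber_eq_of_uniform h G a b
  rw [← FreeGroup.mk_toWord (x := w)] at hcard
  obtain ⟨φ, hφ, hw⟩ := FreeGroup.exists_almost_invariant w.toWord
    (FreeGroup.single_one_mem_span _ fun W _ _ _ ρ v hv =>
      FreeGroup.exists_foxTerms_sum_ne_zero _ hcard ρ hv)
  rw [FreeGroup.mk_toWord] at hw
  exact FreeGroup.exists_equiv_of_almost_invariant hφ hw ⟨0, hr⟩
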